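/- Let U ⊆ ℝⁿ be open and connected (n ≥ 2) and let CS_cpt(U) denote the linear span of all classical symbols of all orders with compact support in U. Let ρ : CS_cpt(U) → ℂ be a linear form which (a) vanishes on smoothing symbols, (b) has Stokes' property: ρ(∂_{ξ_j}τ) = 0 and ρ(∂_{x_j}τ) = 0 for every τ ∈ CS_cpt(U) and every j = 1,…,n, and (c) for each a ∈ ℂ restricts to a continuous linear form on classical symbols of order a with compact support in U, with respect to the Fréchet topology defined by the seminorms σ ↦ sup_{x,ξ}(1+|ξ|)^{−Re(a)+|β|}|∂_x^γ∂_ξ^βσ(x,ξ)|, σ ↦ sup_{x,ξ}(1+|ξ|)^{−Re(a)+N+|β|}|∂_x^γ∂_ξ^β(σ − ∑_{j<N}χσ_{a−j})(x,ξ)|, and σ ↦ sup_{x, |ξ|=1}|∂_x^γ∂_ξ^βσ_{a−j}(x,ξ)| (indexed by multi-indices β, γ and integers j, N ≥ 0). Then ρ is proportional to the noncommutative residue: there exists c ∈ ℂ with ρ(σ) = c·res(σ) for all σ ∈ CS_cpt(U). -/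

import Mathlib

open MeasureTheory Metric Filter Complex
open scoped Topology RealInnerProductSpace Classical

noncomputable section

/-- ℝⁿ with the euclidean norm. -/
abbrev Euc (n : ℕ) := EuclideanSpace ℝ (Fin n)

/-- Partial derivative in the `i`-th coordinate direction. -/
def pd {n : ℕ} (i : Fin n) (f : Euc n → ℂ) : Euc n → ℂ :=
  fun ξ => fderiv ℝ f ξ (EuclideanSpace.single i 1)

/-- Iterated partial derivatives along a list of coordinate directions
(a multi-index `β` corresponds to the lists containing `i` exactly `β i` times). -/
def pdIter {n : ℕ} : List (Fin n) → (Euc n → ℂ) → (Euc n → ℂ)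
  | [], f => f
  | i :: L, f => pd i (pdIter L f)

/-- A smooth cut-off function vanishing near `0` and equal to `1` outside the unit ball. -/
structure IsCutoff {n : ℕ} (χ : Euc n → ℝ) : Prop where
  smooth : ContDiff ℝ (⊤ : ℕ∞) χ
  zero_near : ∃ ε > (0:ℝ), ∀ ξ : Euc n, ‖ξ‖ < ε → χ ξ = 0
  one_far : ∀ ξ : Euc n, 1 ≤ ‖ξ‖ → χ ξ = 1

/-- `σ` is a classical symbol of order `a` with constant coefficients on `ℝⁿ`, with
homogeneous components `σc j` of degree `a - j`. -/
structure IsCS {n : ℕ} (χ : Euc n → ℝ) (a : ℂ) (σ : Euc n → ℂ)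
    (σc : ℕ → Euc n → ℂ) : Prop where
  smooth : ContDiff ℝ (⊤ : ℕ∞) σ
  comp_smooth : ∀ j, ContDiffOn ℝ (⊤ : ℕ∞) (σc j) {(0 : Euc n)}ᶜ
  comp_homog : ∀ (j : ℕ) (t : ℝ), 0 < t → ∀ ξ : Euc n, ξ ≠ 0 →
    σc j (t • ξ) = (t : ℂ) ^ (a - j) * σc j ξ
  estimate : ∀ (N : ℕ) (L : List (Fin n)), ∃ C > (0:ℝ), ∀ ξ : Euc n,
    ‖pdIter L (fun η => σ η - ∑ j ∈ Finset.range N, (χ η : ℂ) * σc j η) ξ‖ ≤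
      C * (1 + ‖ξ‖) ^ (a.re - N - L.length : ℝ)

/-- A smoothing symbol with constant coefficients on `ℝⁿ`. -/
def IsSmoothing {n : ℕ} (σ : Euc n → ℂ) : Prop :=
  ContDiff ℝ (⊤ : ℕ∞) σ ∧
    ∀ (L : List (Fin n)) (M : ℝ), 0 < M → ∃ C > (0:ℝ), ∀ ξ : Euc n,
      ‖pdIter L σ ξ‖ ≤ C * (1 + ‖ξ‖) ^ (-M)

/-- The surface measure on the unit sphere `S^{n-1} ⊂ ℝⁿ`. -/
def sphMeas (n : ℕ) : Measure (sphere (0 : Euc n) 1) :=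
  (volume : Measure (Euc n)).toSphere

/-- The integral of a homogeneous component over the unit sphere. -/
def sphInt {n : ℕ} (f : Euc n → ℂ) : ℂ :=
  ∫ ω : sphere (0 : Euc n) 1, f ↑ω ∂(sphMeas n)

/-- The noncommutative residue of a classical symbol of order `a` with homogeneous
components `σc j` of degree `a - j`. -/
def resCC {n : ℕ} (a : ℂ) (σc : ℕ → Euc n → ℂ) : ℂ :=
  if h : ∃ j : ℕ, a - j = -(n : ℂ) then
    (((2 * Real.pi) ^ (-(n : ℝ) / 2) : ℝ) : ℂ) * sphInt (σc h.choose)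
  else 0

/-- The cut-off regularised integral of a classical symbol of order `a` with homogeneous
components `σc`, computed with an integer `N` such that `Re a - N < -n`. -/
def cutoffInt {n : ℕ} (χ : Euc n → ℝ) (a : ℂ) (σ : Euc n → ℂ)
    (σc : ℕ → Euc n → ℂ) (N : ℕ) : ℂ :=
  (∫ ξ : Euc n, (σ ξ - ∑ j ∈ Finset.range N, (χ ξ : ℂ) * σc j ξ))
  + ∑ j ∈ Finset.range N, ∫ ξ in Metric.ball (0 : Euc n) 1, (χ ξ : ℂ) * σc j ξ
  - ∑ j ∈ Finset.range N,
      if a - j + n ≠ 0 then (a - j + n)⁻¹ * sphInt (σc j) else 0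

/-- Partial derivative in the `i`-th direction of the first (`x`) variable. -/
def pdFst {n : ℕ} (i : Fin n) (f : Euc n → Euc n → ℂ) : Euc n → Euc n → ℂ :=
  fun x ξ => fderiv ℝ (fun x' => f x' ξ) x (EuclideanSpace.single i 1)

/-- Partial derivative in the `i`-th direction of the second (`ξ`) variable. -/
def pdSnd {n : ℕ} (i : Fin n) (f : Euc n → Euc n → ℂ) : Euc n → Euc n → ℂ :=
  fun x ξ => fderiv ℝ (fun ξ' => f x ξ') ξ (EuclideanSpace.single i 1)

/-- Iterated partial derivatives in the first variable. -/
def pdIterFst {n : ℕ} : List (Fin n) → (Euc n → Euc n → ℂ) → (Euc n → Euc n → ℂ)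
  | [], f => f
  | i :: L, f => pdFst i (pdIterFst L f)

/-- Iterated partial derivatives in the second variable. -/
def pdIterSnd {n : ℕ} : List (Fin n) → (Euc n → Euc n → ℂ) → (Euc n → Euc n → ℂ)
  | [], f => f
  | i :: L, f => pdSnd i (pdIterSnd L f)

/-- `σ` is a classical symbol of order `a` with compact support in `U`, with homogeneous
components `σc j` of degree `a - j` in `ξ`. -/
structure IsCSCpt {n : ℕ} (U : Set (Euc n)) (χ : Euc n → ℝ) (a : ℂ)
    (σ : Euc n → Euc n → ℂ) (σc : ℕ → Euc n → Euc n → ℂ) : Prop where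
  smooth : ContDiff ℝ (⊤ : ℕ∞) (fun p : Euc n × Euc n => σ p.1 p.2)
  supp : ∃ K : Set (Euc n), IsCompact K ∧ K ⊆ U ∧
    ∀ x ∉ K, (∀ ξ, σ x ξ = 0) ∧ ∀ j ξ, σc j x ξ = 0
  comp_smooth : ∀ j, ContDiffOn ℝ (⊤ : ℕ∞) (fun p : Euc n × Euc n => σc j p.1 p.2)
    {p : Euc n × Euc n | p.2 ≠ 0}
  comp_homog : ∀ (j : ℕ) (t : ℝ), 0 < t → ∀ (x : Euc n) (ξ : Euc n), ξ ≠ 0 →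
    σc j x (t • ξ) = (t : ℂ) ^ (a - j) * σc j x ξ
  estimate : ∀ (N : ℕ) (Lξ Lx : List (Fin n)), ∃ C > (0:ℝ), ∀ (x ξ : Euc n),
    ‖pdIterSnd Lξ (pdIterFst Lx
        (fun y η => σ y η - ∑ j ∈ Finset.range N, (χ η : ℂ) * σc j y η)) x ξ‖ ≤
      C * (1 + ‖ξ‖) ^ (a.re - N - Lξ.length : ℝ)

/-- A smoothing symbol with compact support in `U`. -/
def IsSmoothingCpt {n : ℕ} (U : Set (Euc n)) (σ : Euc n → Euc n → ℂ) : Prop :=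
  ContDiff ℝ (⊤ : ℕ∞) (fun p : Euc n × Euc n => σ p.1 p.2) ∧
  (∃ K : Set (Euc n), IsCompact K ∧ K ⊆ U ∧ ∀ x ∉ K, ∀ ξ, σ x ξ = 0) ∧
  ∀ (Lξ Lx : List (Fin n)) (M : ℝ), 0 < M → ∃ C > (0:ℝ), ∀ (x ξ : Euc n),
    ‖pdIterSnd Lξ (pdIterFst Lx σ) x ξ‖ ≤ C * (1 + ‖ξ‖) ^ (-M)

/-- The noncommutative residue of a classical symbol with compact support in `U`. -/
def resCpt {n : ℕ} (U : Set (Euc n)) (a : ℂ) (σc : ℕ → Euc n → Euc n → ℂ) : ℂ :=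
  if h : ∃ j : ℕ, a - j = -(n : ℂ) then
    ((((2 * Real.pi) ^ n)⁻¹ : ℝ) : ℂ) *
      ∫ x in U, sphInt (σc h.choose x)
  else 0

/-- The linear span of all classical symbols with compact support in `U`. -/
def CSCptSpan {n : ℕ} (U : Set (Euc n)) (χ : Euc n → ℝ) :
    Submodule ℂ (Euc n → Euc n → ℂ) :=
  Submodule.span ℂ {σ | ∃ a σc, IsCSCpt U χ a σ σc}

open scoped ContDiff

/-! ### Directional derivatives and parametric integrals -/

section DirDeriv

variable {E : Type*} [NormedAddCommGroup E] [NormedSpace ℝ E]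

/-- The derivative of `F` in the direction `v`. -/
def dirDeriv (v : E) (F : E → ℂ) : E → ℂ := fun p => fderiv ℝ F p v

theorem ContDiffOn.dirDeriv {F : E → ℂ} {O : Set E} (hO : IsOpen O)
    (hF : ContDiffOn ℝ ∞ F O) (v : E) : ContDiffOn ℝ ∞ (dirDeriv v F) O :=
  (hF.fderiv_of_isOpen hO (by simp)).clm_apply contDiffOn_const

theorem ContDiff.dirDeriv {F : E → ℂ} (hF : ContDiff ℝ ∞ F) (v : E) :
    ContDiff ℝ ∞ (dirDeriv v F) :=
  (hF.fderiv_right (by simp)).clm_apply contDiff_const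

theorem HasCompactSupport.dirDeriv {F : E → ℂ} (hF : HasCompactSupport F) (v : E) :
    HasCompactSupport (dirDeriv v F) :=
  hF.fderiv_apply ℝ v

theorem dirDeriv_add {F G : E → ℂ} (hF : ContDiff ℝ ∞ F) (hG : ContDiff ℝ ∞ G) (v : E) :
    dirDeriv v (F + G) = dirDeriv v F + dirDeriv v G := by
  ext p
  simp only [dirDeriv, Pi.add_apply]
  rw [fderiv_add (hF.differentiable (by simp) p) (hG.differentiable (by simp) p)]
  rfl

theorem dirDeriv_mul_apply {F G : E → ℂ} {p : E} (hF : DifferentiableAt ℝ F p)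
    (hG : DifferentiableAt ℝ G p) (v : E) :
    dirDeriv v (fun q => F q * G q) p = dirDeriv v F p * G p + F p * dirDeriv v G p := by
  simp only [dirDeriv]
  rw [fderiv_fun_mul hF hG]
  simp only [add_apply, smul_apply, smul_eq_mul]
  ring

theorem dirDeriv_eqOn {F G : E → ℂ} {O : Set E} (hO : IsOpen O) (h : Set.EqOn F G O) (v : E) :
    Set.EqOn (dirDeriv v F) (dirDeriv v G) O := fun p hp => by
  simp only [dirDeriv]
  rw [(h.eventuallyEq_of_mem (hO.mem_nhds hp)).fderiv_eq]

theorem dirDeriv_eq_zero {F : E → ℂ} {O : Set E} (hO : IsOpen O) (h : ∀ p ∈ O, F p = 0) (v : E) :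
    ∀ p ∈ O, dirDeriv v F p = 0 := fun p hp => by
  rw [dirDeriv_eqOn hO (G := fun _ => 0) h v hp]
  simp [dirDeriv]

theorem HasDerivAt.dirDeriv_eq {F : E → ℂ} {p v : E} {c : ℂ} (hF : DifferentiableAt ℝ F p)
    (h : HasDerivAt (fun t : ℝ => F (p + t • v)) c 0) : dirDeriv v F p = c := by
  have := (hF.hasFDerivAt.hasLineDerivAt v).lineDeriv
  rw [dirDeriv, ← this]
  exact HasLineDerivAt.lineDeriv h

end DirDeriv

section ParametricIntegral

variable {P : Type*} [NormedAddCommGroup P] [NormedSpace ℝ P]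

omit [NormedAddCommGroup P] [NormedSpace ℝ P] in
theorem convolution_neg_eq_integral (w : ℝ → ℂ) (H : P × ℝ → ℂ) (p : P) :
    (convolution w (fun t => H (p, -t)) (ContinuousLinearMap.mul ℝ ℂ) volume) 0 =
      ∫ t, w t * H (p, t) := by
  simp [convolution]

theorem contDiffOn_integral_mul {w : ℝ → ℂ} (hw : LocallyIntegrable w) {H : P × ℝ → ℂ}
    {s : Set P} (hs : IsOpen s) {k : Set ℝ} (hk : IsCompact k)
    (h0 : ∀ p ∈ s, ∀ t ∉ k, H (p, t) = 0) (hH : ContDiffOn ℝ ∞ H (s ×ˢ Set.univ)) :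
    ContDiffOn ℝ ∞ (fun p => ∫ t, w t * H (p, t)) s := by
  have hH' : ContDiffOn ℝ ∞ (fun q : P × ℝ => H (q.1, -q.2)) (s ×ˢ Set.univ) :=
    hH.comp (by fun_prop) fun q hq => ⟨hq.1, trivial⟩
  have := contDiffOn_convolution_right_with_param_comp (n := ⊤) (ContinuousLinearMap.mul ℝ ℂ)
    (v := fun _ => 0) contDiffOn_const (g := fun p t => H (p, -t)) hs hk.neg
    (fun p t hp ht => h0 p hp _ (by simpa using ht)) hw hH'
  exact this.congr fun p _ => (convolution_neg_eq_integral w H p).symm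

theorem dirDeriv_integral_mul {w : ℝ → ℂ} (hw : LocallyIntegrable w) {H : P × ℝ → ℂ}
    {s : Set P} (hs : IsOpen s) {k : Set ℝ} (hk : IsCompact k)
    (h0 : ∀ p ∈ s, ∀ t ∉ k, H (p, t) = 0) (hH : ContDiffOn ℝ ∞ H (s ×ˢ Set.univ))
    {p : P} (hp : p ∈ s) (v : P) :
    dirDeriv v (fun p => ∫ t, w t * H (p, t)) p =
      ∫ t, w t * dirDeriv v (fun p' => H (p', t)) p := by
  have hH' : ContDiffOn ℝ ∞ (fun q : P × ℝ => H (q.1, -q.2)) (s ×ˢ Set.univ) :=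
    hH.comp (by fun_prop) fun q hq => ⟨hq.1, trivial⟩
  have hd := hasFDerivAt_convolution_right_with_param (ContinuousLinearMap.mul ℝ ℂ)
    (g := fun p t => H (p, -t)) hs hk.neg
    (fun p t hp ht => h0 p hp _ (by simpa using ht)) hw (hH'.of_le (by simp)) (p, 0) hp
  have hcong : (fun p => ∫ t, w t * H (p, t)) =
      (fun q : P × ℝ => (convolution w (fun t => H (q.1, -t)) (ContinuousLinearMap.mul ℝ ℂ)
        volume) q.2) ∘ fun x => (x, 0) := by
    ext p
    exact (convolution_neg_eq_integral w H p).symm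
  have hin : HasFDerivAt (fun x : P => (x, (0 : ℝ)))
      ((ContinuousLinearMap.id ℝ P).prod (0 : P →L[ℝ] ℝ)) p :=
    (hasFDerivAt_id p).prodMk (hasFDerivAt_const (0 : ℝ) p)
  have hd2 := HasFDerivAt.comp (f := fun x : P => (x, (0 : ℝ))) p hd hin
  have hsk : IsOpen (s ×ˢ (-k)ᶜ) := hs.prod hk.neg.isClosed.isOpen_compl
  have hsupp : HasCompactSupport
      (fun x : ℝ => fderiv ℝ (fun q : P × ℝ => H (q.1, -q.2)) (p, x)) := by
    refine HasCompactSupport.intro hk.neg fun x hx => ?_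
    have : (fun q : P × ℝ => H (q.1, -q.2)) =ᶠ[𝓝 (p, x)] fun _ => 0 := by
      filter_upwards [hsk.mem_nhds ⟨hp, hx⟩] with q hq
      exact h0 _ hq.1 _ (by simpa using hq.2)
    rw [this.fderiv_eq]
    simp
  have hcont : Continuous (fun x : ℝ => fderiv ℝ (fun q : P × ℝ => H (q.1, -q.2)) (p, x)) :=
    (hH'.continuousOn_fderiv_of_isOpen (hs.prod isOpen_univ) (by simp)).comp_continuous
      (by fun_prop) fun x => ⟨hp, trivial⟩
  rw [hcong, dirDeriv, hd2.fderiv, ContinuousLinearMap.comp_apply]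
  refine (convolution_precompR_apply (ContinuousLinearMap.mul ℝ ℂ) hw hsupp hcont 0 _).trans ?_
  simp only [convolution, ContinuousLinearMap.mul_apply', zero_sub]
  refine integral_congr_ae (Eventually.of_forall fun t => ?_)
  have hdiff : DifferentiableAt ℝ (fun q : P × ℝ => H (q.1, -q.2)) (p, -t) :=
    (hH'.differentiableOn (by simp)).differentiableAt
      ((hs.prod isOpen_univ).mem_nhds ⟨hp, trivial⟩)
  have hin' : HasFDerivAt (fun x : P => (x, -t))
      ((ContinuousLinearMap.id ℝ P).prod (0 : P →L[ℝ] ℝ)) p :=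
    (hasFDerivAt_id p).prodMk (hasFDerivAt_const (-t) p)
  have := (HasFDerivAt.comp (f := fun x : P => (x, -t)) p hdiff.hasFDerivAt hin').fderiv
  simp only [Function.comp_def, neg_neg] at this
  simp only [dirDeriv, this]
  rfl

end ParametricIntegral

/-! ### Test functions modulo divergences on a connected open set -/

section TestFn

variable {E : Type*} [NormedAddCommGroup E] [NormedSpace ℝ E]

/-- `f` is smooth with compact support contained in `W`. -/
def IsTestFn (W : Set E) (f : E → ℂ) : Prop :=
  ContDiff ℝ ∞ f ∧ ∃ K, IsCompact K ∧ K ⊆ W ∧ ∀ x ∉ K, f x = 0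

theorem IsTestFn.mono {V W : Set E} (h : V ⊆ W) {f : E → ℂ} (hf : IsTestFn V f) :
    IsTestFn W f :=
  let ⟨h1, K, hK, hKV, h0⟩ := hf
  ⟨h1, K, hK, hKV.trans h, h0⟩

theorem IsTestFn.add {W : Set E} {f g : E → ℂ} (hf : IsTestFn W f) (hg : IsTestFn W g) :
    IsTestFn W (f + g) := by
  obtain ⟨h1, K, hK, hKW, h0⟩ := hf
  obtain ⟨h1', K', hK', hKW', h0'⟩ := hg
  refine ⟨h1.add h1', K ∪ K', hK.union hK', Set.union_subset hKW hKW', fun x hx => ?_⟩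
  rw [Set.mem_union, not_or] at hx
  simp [h0 x hx.1, h0' x hx.2]

theorem IsTestFn.smul {W : Set E} {f : E → ℂ} (hf : IsTestFn W f) (c : ℂ) :
    IsTestFn W (c • f) := by
  obtain ⟨h1, K, hK, hKW, h0⟩ := hf
  exact ⟨h1.const_smul c, K, hK, hKW, fun x hx => by simp [h0 x hx]⟩

theorem IsTestFn.zero {W : Set E} : IsTestFn W (0 : E → ℂ) :=
  ⟨contDiff_const, ∅, isCompact_empty, Set.empty_subset _, fun _ _ => rfl⟩

theorem IsTestFn.hasCompactSupport {W : Set E} {f : E → ℂ} (hf : IsTestFn W f) :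
    HasCompactSupport f :=
  let ⟨_, _, hK, _, h0⟩ := hf
  HasCompactSupport.intro hK h0

theorem IsTestFn.dirDeriv {W : Set E} {f : E → ℂ} (hf : IsTestFn W f) (v : E) :
    IsTestFn W (dirDeriv v f) := by
  obtain ⟨h1, K, hK, hKW, h0⟩ := hf
  exact ⟨h1.dirDeriv v, K, hK, hKW, dirDeriv_eq_zero hK.isClosed.isOpen_compl h0 v⟩

/-- The span of the derivatives, in the directions `e i`, of test functions on `W`. -/
def divSpan {ι : Type*} (e : ι → E) (W : Set E) : Submodule ℂ (E → ℂ) :=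
  Submodule.span ℂ {F | ∃ g i, IsTestFn W g ∧ F = dirDeriv (e i) g}

end TestFn

section Poincare

variable {E : Type*} [NormedAddCommGroup E] [NormedSpace ℝ E]
  {ι : Type*} [Fintype ι] (L : E ≃L[ℝ] (ι → ℝ))

/-- The basis vectors of `E` attached to the linear coordinates `L`. -/
def coordVec (i : ι) : E := L.symm (Pi.single i 1)

omit [Fintype ι] in
theorem coord_add_smul_same (x : E) (t : ℝ) (i : ι) :
    L (x + t • coordVec L i) i = L x i + t := by
  simp [coordVec]

omit [Fintype ι] in
theorem coord_add_smul_ne (x : E) (t : ℝ) {i j : ι} (h : j ≠ i) :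
    L (x + t • coordVec L i) j = L x j := by
  simp [coordVec, h]

theorem contDiff_coord (i : ι) : ContDiff ℝ ∞ (fun x => L x i) :=
  (contDiff_apply ℝ ℝ i).comp L.contDiff

/-- The primitive of `v` along the `i`-th coordinate lines. -/
def linePrimitive (i : ι) (v : E → ℂ) (x : E) : ℂ :=
  ∫ t in Set.Iic (0 : ℝ), v (x + t • coordVec L i)

variable {L} {i : ι} {v : E → ℂ} {α β : ℝ}

theorem contDiff_linePrimitive (hv : ContDiff ℝ ∞ v)
    (h0 : ∀ x, L x i ∉ Set.Icc α β → v x = 0) : ContDiff ℝ ∞ (linePrimitive L i v) := by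
  rw [contDiff_iff_contDiffAt]
  intro x₀
  set s : Set E := {x | |L x i - L x₀ i| < 1} with hs
  have hso : IsOpen s :=
    isOpen_lt (((contDiff_coord L i).continuous.sub continuous_const).abs) continuous_const
  have hw : LocallyIntegrable (Set.indicator (Set.Iic (0 : ℝ)) (fun _ => (1 : ℂ))) :=
    (locallyIntegrable_const (1 : ℂ)).indicator measurableSet_Iic
  have := contDiffOn_integral_mul hw (H := fun q : E × ℝ => v (q.1 + q.2 • coordVec L i)) hso
    (isCompact_Icc (a := α - 1 - L x₀ i) (b := β + 1 - L x₀ i)) ?_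
    ((hv.comp (by fun_prop)).contDiffOn)
  · refine (this.contDiffAt (hso.mem_nhds (by simp [hs]))).congr_of_eventuallyEq
      (Eventually.of_forall fun x => ?_)
    rw [linePrimitive, ← integral_indicator measurableSet_Iic]
    congr 1
    ext t
    by_cases ht : t ≤ 0 <;> simp [ht]
  · intro x hx t ht
    refine h0 _ fun h => ht ?_
    rw [coord_add_smul_same] at h
    simp only [hs, Set.mem_ofPred_eq, abs_lt] at hx
    constructor <;> linarith [h.1, h.2, hx.1, hx.2]

omit [Fintype ι] in
theorem linePrimitive_eq_zero (h0 : ∀ x, L x i ∉ Set.Icc α β → v x = 0)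
    (hint : ∀ x, ∫ t : ℝ, v (x + t • coordVec L i) = 0) {x : E} (hx : L x i ∉ Set.Icc α β) :
    linePrimitive L i v x = 0 := by
  by_cases h : L x i < α
  · refine setIntegral_eq_zero_of_forall_eq_zero fun t ht => h0 _ fun h' => ?_
    rw [coord_add_smul_same] at h'
    linarith [h'.1, Set.mem_Iic.1 ht]
  · rw [linePrimitive, setIntegral_eq_integral_of_forall_compl_eq_zero, hint]
    intro t ht
    refine h0 _ fun h' => hx ?_
    rw [coord_add_smul_same] at h'
    simp only [Set.mem_Iic, not_le] at ht
    exact ⟨not_lt.1 h, by linarith [h'.2]⟩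

theorem dirDeriv_linePrimitive (hv : ContDiff ℝ ∞ v)
    (h0 : ∀ x, L x i ∉ Set.Icc α β → v x = 0) :
    dirDeriv (coordVec L i) (linePrimitive L i v) = v := by
  ext x
  refine HasDerivAt.dirDeriv_eq
    ((contDiff_linePrimitive hv h0).differentiable (by simp) x) ?_
  set g : ℝ → ℂ := fun s => v (x + s • coordVec L i) with hg
  have hgc : Continuous g := hv.continuous.comp (by fun_prop)
  have hgs : HasCompactSupport g := by
    refine HasCompactSupport.intro (isCompact_Icc (a := α - L x i) (b := β - L x i))
      fun t ht => h0 _ fun h => ht ?_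
    rw [coord_add_smul_same] at h
    constructor <;> linarith [h.1, h.2]
  have hgi : Integrable g := hgc.integrable_of_hasCompactSupport hgs
  have key : ∀ τ : ℝ, linePrimitive L i v (x + τ • coordVec L i) =
      (∫ s in (0 : ℝ)..τ, g s) + ∫ s in Set.Iic 0, g s := by
    intro τ
    rw [← intervalIntegral.integral_Iic_sub_Iic hgi.integrableOn hgi.integrableOn,
      sub_add_cancel, linePrimitive, ← integral_indicator measurableSet_Iic,
      ← integral_indicator measurableSet_Iic,
      ← integral_add_right_eq_self ((Set.Iic τ).indicator _) τ]
    congr 1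
    ext t
    simp [hg, Set.indicator, add_smul, add_assoc, add_comm]
  simp_rw [key]
  have := (intervalIntegral.integral_hasDerivAt_right (hgi.intervalIntegrable (a := 0) (b := 0))
    hgc.stronglyMeasurable.stronglyMeasurableAtFilter hgc.continuousAt).add_const
      (∫ s in Set.Iic 0, g s)
  simpa [hg] using this


omit [Fintype ι] in
theorem apply_eq_of_forall_add_coordVec [Finite ι] {u : E → ℂ}
    (hu : ∀ (i : ι) (x : E) (t : ℝ), u (x + t • coordVec L i) = u x) (x : E) : u x = u 0 := by
  have := Fintype.ofFinite ι
  have key : ∀ s : Finset ι, u (∑ i ∈ s, L x i • coordVec L i) = u 0 := by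
    intro s
    induction s using Finset.induction_on with
    | empty => simp
    | insert i s hi ih => rw [Finset.sum_insert hi, add_comm, hu, ih]
  rw [← key Finset.univ]
  congr 1
  apply L.injective
  ext j
  simp [coordVec, Finset.sum_apply, Pi.single_apply]

omit [Fintype ι] in
theorem prod_coord_add_smul {φ : ι → ℝ → ℝ} {s : Finset ι} (hi : i ∉ s) (x : E) (t : ℝ) :
    ∏ j ∈ s, (φ j (L (x + t • coordVec L i) j) : ℂ) = ∏ j ∈ s, (φ j (L x j) : ℂ) :=
  Finset.prod_congr rfl fun j hj => by
    rw [coord_add_smul_ne]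
    rintro rfl
    exact hi hj

theorem exists_sub_prod_mul_mem_divSpan {W : Set E} {α β : ι → ℝ}
    (hQ : L ⁻¹' (Set.univ.pi fun i => Set.Icc (α i) (β i)) ⊆ W)
    {φ : ι → ℝ → ℝ} (hφ : ∀ i, ContDiff ℝ ∞ (φ i)) (hφ0 : ∀ i, ∀ t ∉ Set.Icc (α i) (β i), φ i t = 0)
    (hφ1 : ∀ i, ∫ t, φ i t = 1) {f : E → ℂ} (hf : ContDiff ℝ ∞ f)
    (hf0 : ∀ x i, L x i ∉ Set.Icc (α i) (β i) → f x = 0) (s : Finset ι) :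
    ∃ u : E → ℂ, ContDiff ℝ ∞ u ∧ (∀ j ∈ s, ∀ x (t : ℝ), u (x + t • coordVec L j) = u x) ∧
      (∀ x, ∀ j ∉ s, L x j ∉ Set.Icc (α j) (β j) → u x = 0) ∧
      (f - fun x => (∏ j ∈ s, (φ j (L x j) : ℂ)) * u x) ∈ divSpan (coordVec L) W := by
  induction s using Finset.induction_on with
  | empty =>
    refine ⟨f, hf, by simp, fun x j _ => hf0 x j, ?_⟩
    have : (f - fun x => (∏ j ∈ (∅ : Finset ι), (φ j (L x j) : ℂ)) * f x) = 0 := by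
      ext; simp
    rw [this]
    exact zero_mem _
  | insert i s hi ih =>
    obtain ⟨u, hu, hinv, hu0, hmem⟩ := ih
    set u' : E → ℂ := fun x => ∫ t : ℝ, u (x + (t - L x i) • coordVec L i) with hu'def
    have hu' : ContDiff ℝ ∞ u' := by
      rw [← contDiffOn_univ]
      refine (contDiffOn_integral_mul (locallyIntegrable_const (1 : ℂ))
        (H := fun q : E × ℝ => u (q.1 + (q.2 - L q.1 i) • coordVec L i)) isOpen_univ
        (isCompact_Icc (a := α i) (b := β i)) ?_ ?_).congr fun x _ => by simp [hu'def]
      · intro x _ t ht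
        refine hu0 _ i hi ?_
        rwa [coord_add_smul_same, add_sub_cancel]
      · have := contDiff_coord L i
        exact (hu.comp (by fun_prop)).contDiffOn
    have hline : ∀ x, ∫ t : ℝ, u (x + t • coordVec L i) = u' x := fun x =>
      (integral_sub_right_eq_self (fun t => u (x + t • coordVec L i)) (L x i)).symm
    have hinv_i : ∀ x (t : ℝ), u' (x + t • coordVec L i) = u' x := by
      intro x t
      rw [← hline, ← hline]
      rw [← integral_add_left_eq_self (fun s => u (x + s • coordVec L i)) t]
      simp only [add_smul, add_assoc]
    have hinv_s : ∀ j ∈ s, ∀ x (t : ℝ), u' (x + t • coordVec L j) = u' x := by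
      intro j hj x t
      rw [← hline, ← hline]
      congr 1
      ext r
      rw [add_right_comm, hinv j hj]
    have hu'0 : ∀ x, ∀ j ∉ insert i s, L x j ∉ Set.Icc (α j) (β j) → u' x = 0 := by
      intro x j hj hx
      rw [Finset.mem_insert, not_or] at hj
      rw [← hline]
      refine integral_eq_zero_of_ae (Eventually.of_forall fun t => hu0 _ j hj.2 ?_)
      rwa [coord_add_smul_ne _ _ _ hj.1]
    refine ⟨u', hu', ?_, hu'0, ?_⟩
    · intro j hj
      rcases Finset.mem_insert.1 hj with rfl | hj
      · exact hinv_i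
      · exact hinv_s j hj
    set P : E → ℂ := fun x => ∏ j ∈ s, (φ j (L x j) : ℂ) with hP
    have hPs : ContDiff ℝ ∞ P := contDiff_prod fun j _ =>
      ofRealCLM.contDiff.comp ((hφ j).comp (contDiff_coord L j))
    set v : E → ℂ := fun x => P x * (u x - φ i (L x i) * u' x) with hvdef
    have hφc : ContDiff ℝ ∞ (fun x => (φ i (L x i) : ℂ)) :=
      ofRealCLM.contDiff.comp ((hφ i).comp (contDiff_coord L i))
    have hv : ContDiff ℝ ∞ v := hPs.mul (hu.sub (hφc.mul hu'))
    have hv0 : ∀ x j, L x j ∉ Set.Icc (α j) (β j) → v x = 0 := by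
      intro x j hx
      by_cases hj : j ∈ s
      · have : P x = 0 := Finset.prod_eq_zero hj (by simp [hφ0 j _ hx])
        simp [hvdef, this]
      · have h1 := hu0 x j hj hx
        by_cases hji : j = i
        · subst hji
          simp [hvdef, h1, hφ0 _ _ hx]
        · simp [hvdef, h1, hu'0 x j (by simp [hj, hji]) hx]
    have hvint : ∀ x, ∫ t : ℝ, v (x + t • coordVec L i) = 0 := by
      intro x
      have hc : Continuous fun t : ℝ => u (x + t • coordVec L i) :=
        hu.continuous.comp (by fun_prop)
      have hcs : HasCompactSupport fun t : ℝ => u (x + t • coordVec L i) := by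
        refine HasCompactSupport.intro (isCompact_Icc (a := α i - L x i) (b := β i - L x i))
          fun t ht => hu0 _ i hi fun h => ht ?_
        rw [coord_add_smul_same] at h
        constructor <;> linarith [h.1, h.2]
      have hφi : Integrable (φ i) :=
        (hφ i).continuous.integrable_of_hasCompactSupport
          (HasCompactSupport.intro isCompact_Icc (hφ0 i))
      have hφI : Integrable fun t : ℝ => (φ i (L x i + t) : ℂ) * u' x :=
        Integrable.mul_const ((hφi.comp_add_left _).ofReal) _
      simp only [hvdef, hinv_i, coord_add_smul_same, hP, prod_coord_add_smul hi]
      rw [integral_const_mul, integral_sub (hc.integrable_of_hasCompactSupport hcs)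
        hφI, hline, integral_mul_const,
        integral_complex_ofReal, integral_add_left_eq_self (φ i), hφ1]
      simp
    have hG : IsTestFn W (linePrimitive L i v) := by
      refine ⟨contDiff_linePrimitive hv fun x => hv0 x i, _,
        L.toHomeomorph.isCompact_preimage.2
          (isCompact_univ_pi fun i => isCompact_Icc (a := α i) (b := β i)), hQ, fun x hx => ?_⟩
      simp only [Set.mem_preimage, Set.mem_pi, Set.mem_univ, true_implies, not_forall] at hx
      obtain ⟨j, hj⟩ := hx
      by_cases hji : j = i
      · subst hji
        exact linePrimitive_eq_zero (fun x => hv0 x _) hvint hj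
      · refine setIntegral_eq_zero_of_forall_eq_zero fun t _ => hv0 _ j ?_
        rw [coord_add_smul_ne _ _ _ hji]
        exact hj
    have hvm : v ∈ divSpan (coordVec L) W :=
      Submodule.subset_span ⟨_, i, hG, (dirDeriv_linePrimitive hv fun x => hv0 x i).symm⟩
    convert add_mem hmem hvm using 1
    ext x
    simp only [hvdef, hP, Pi.sub_apply, Pi.add_apply, Finset.prod_insert hi]
    ring

theorem exists_sub_smul_prod_mem_divSpan {W : Set E} {α β : ι → ℝ}
    (hQ : L ⁻¹' (Set.univ.pi fun i => Set.Icc (α i) (β i)) ⊆ W)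
    {φ : ι → ℝ → ℝ} (hφ : ∀ i, ContDiff ℝ ∞ (φ i)) (hφ0 : ∀ i, ∀ t ∉ Set.Icc (α i) (β i), φ i t = 0)
    (hφ1 : ∀ i, ∫ t, φ i t = 1) {f : E → ℂ} (hf : ContDiff ℝ ∞ f)
    (hf0 : ∀ x i, L x i ∉ Set.Icc (α i) (β i) → f x = 0) :
    ∃ κ : ℂ, (f - κ • fun x => ∏ j, (φ j (L x j) : ℂ)) ∈ divSpan (coordVec L) W := by
  obtain ⟨u, -, hinv, -, hmem⟩ :=
    exists_sub_prod_mul_mem_divSpan hQ hφ hφ0 hφ1 hf hf0 Finset.univ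
  refine ⟨u 0, ?_⟩
  convert hmem using 2
  ext x
  rw [apply_eq_of_forall_add_coordVec (fun i => hinv i (Finset.mem_univ i)) x]
  simp [mul_comm]


variable (L) in
/-- A product bump function around `p`, with support of size `r` in the coordinates `L`. -/
def coordBump (p : E) {r : ℝ} (hr : 0 < r) : E → ℝ :=
  fun x => ∏ j, (⟨r / 2, r, by positivity, by linarith⟩ : ContDiffBump (L p j)).normed volume (L x j)

theorem contDiff_coordBump (p : E) {r : ℝ} (hr : 0 < r) : ContDiff ℝ ∞ (coordBump L p hr) :=
  contDiff_prod fun j _ => (ContDiffBump.contDiff_normed _).comp (contDiff_coord L j)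

theorem coordBump_nonneg (p : E) {r : ℝ} (hr : 0 < r) (x : E) : 0 ≤ coordBump L p hr x :=
  Finset.prod_nonneg fun _ _ => ContDiffBump.nonneg_normed _ _

theorem normed_contDiffBump_eq_zero {a r : ℝ} (hr : 0 < r) {t : ℝ}
    (ht : t ∉ Set.Icc (a - r) (a + r)) :
    (⟨r / 2, r, by positivity, by linarith⟩ : ContDiffBump a).normed volume t = 0 := by
  rw [← Function.notMem_support, ContDiffBump.support_normed_eq, Real.ball_eq_Ioo]
  exact fun h => ht (Set.Ioo_subset_Icc_self h)

theorem coordBump_self_pos (p : E) {r : ℝ} (hr : 0 < r) : 0 < coordBump L p hr p :=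
  Finset.prod_pos fun j _ => by
    refine lt_of_le_of_ne (ContDiffBump.nonneg_normed _ _) (Ne.symm ?_)
    rw [← Function.mem_support, ContDiffBump.support_normed_eq]
    exact mem_ball_self hr

theorem isTestFn_coordBump {W : Set E} {p : E} {r : ℝ} (hr : 0 < r)
    (hW : L ⁻¹' closedBall (L p) r ⊆ W) : IsTestFn W fun x => (coordBump L p hr x : ℂ) := by
  refine ⟨ofRealCLM.contDiff.comp (contDiff_coordBump p hr), _,
    L.toHomeomorph.isCompact_preimage.2 (isCompact_closedBall (L p) r), hW, fun x hx => ?_⟩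
  change L x ∉ closedBall (L p) r at hx
  rw [← Set.mem_compl_iff, closedBall_pi _ hr.le, Set.mem_compl_iff] at hx
  simp only [Set.mem_pi, Set.mem_univ, true_implies, not_forall] at hx
  obtain ⟨j, hj⟩ := hx
  rw [Real.closedBall_eq_Icc] at hj
  have h0 : coordBump L p hr x = 0 :=
    Finset.prod_eq_zero (Finset.mem_univ j) (normed_contDiffBump_eq_zero hr hj)
  simp [h0]

variable (L) in
theorem exists_coordBox_subset {W : Set E} (hW : IsOpen W) {p : E} (hp : p ∈ W) :
    ∃ r > 0, L ⁻¹' closedBall (L p) r ⊆ W := by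
  have : L '' W ∈ 𝓝 (L p) := (L.toHomeomorph.isOpenMap W hW).mem_nhds ⟨p, hp, rfl⟩
  obtain ⟨r, hr, h⟩ := Metric.nhds_basis_closedBall.mem_iff.1 this
  refine ⟨r, hr, fun x hx => ?_⟩
  obtain ⟨y, hy, hxy⟩ := h hx
  rwa [← L.injective hxy]

theorem exists_sub_smul_coordBump_mem_divSpan {W : Set E} {p q : E} {r s : ℝ} (hs : 0 < s)
    (hr : 0 < r) (hW : L ⁻¹' closedBall (L p) r ⊆ W)
    (hqp : L ⁻¹' closedBall (L q) s ⊆ L ⁻¹' closedBall (L p) r)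
    {f : E → ℂ} (hf : IsTestFn (L ⁻¹' closedBall (L p) r) f) :
    ∃ κ : ℂ, (f - κ • fun x => (coordBump L q hs x : ℂ)) ∈ divSpan (coordVec L) W := by
  have hbox : L ⁻¹' closedBall (L p) r =
      L ⁻¹' (Set.univ.pi fun i => Set.Icc (L p i - r) (L p i + r)) := by
    rw [closedBall_pi _ hr.le]
    simp only [Real.closedBall_eq_Icc]
  have hsub : ∀ j, Set.Icc (L q j - s) (L q j + s) ⊆ Set.Icc (L p j - r) (L p j + r) := by
    intro j
    rw [← Real.closedBall_eq_Icc, ← Real.closedBall_eq_Icc]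
    intro t ht
    have h1 : L.symm (Function.update (L q) j t) ∈ L ⁻¹' closedBall (L q) s := by
      simp only [Set.mem_preimage, ContinuousLinearEquiv.apply_symm_apply]
      rw [closedBall_pi _ hs.le]
      intro k _
      by_cases hk : k = j
      · subst hk; simpa using ht
      · simp [hk, hs.le]
    have h2 := hqp h1
    simp only [Set.mem_preimage, ContinuousLinearEquiv.apply_symm_apply] at h2
    rw [closedBall_pi _ hr.le] at h2
    simpa using h2 j trivial
  obtain ⟨hf1, K, -, hKQ, hK0⟩ := hf
  have := exists_sub_smul_prod_mem_divSpan (L := L) (W := W) (hbox ▸ hW)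
    (φ := fun j => (⟨s / 2, s, by positivity, by linarith⟩ : ContDiffBump (L q j)).normed volume)
    (fun j => ContDiffBump.contDiff_normed _)
    (fun j t ht => normed_contDiffBump_eq_zero hs fun h => ht (hsub j h))
    (fun j => ContDiffBump.integral_normed _) hf1 (fun x j hx => hK0 x fun h => hx ?_)
  · simpa [coordBump] using this
  · have := hKQ h
    rw [hbox] at this
    exact this j trivial

variable (L) in
theorem isTestFn_mem_divSpan_sup_of_isPreconnected {W : Set E} (hW : IsOpen W)
    (hWc : IsPreconnected W) {p₀ : E} {r₀ : ℝ} (hr₀ : 0 < r₀)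
    (hp₀ : L ⁻¹' closedBall (L p₀) r₀ ⊆ W) {f : E → ℂ} (hf : IsTestFn W f) :
    f ∈ divSpan (coordVec L) W ⊔ Submodule.span ℂ {fun x => (coordBump L p₀ hr₀ x : ℂ)} := by
  set T := divSpan (coordVec L) W ⊔ Submodule.span ℂ {fun x => (coordBump L p₀ hr₀ x : ℂ)}
    with hT
  have hle : divSpan (coordVec L) W ≤ T := le_sup_left
  have hmemT : ∀ (g Φ : E → ℂ), Φ ∈ T → (∃ κ : ℂ, (g - κ • Φ) ∈ divSpan (coordVec L) W) →
      g ∈ T := by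
    rintro g Φ hΦ ⟨κ, h⟩
    have := add_mem (hle h) (T.smul_mem κ hΦ)
    rwa [sub_add_cancel] at this
  set A : Set E := {p | ∃ V, IsOpen V ∧ p ∈ V ∧ ∀ g, IsTestFn V g → g ∈ T} with hA
  have hAo : IsOpen A := by
    rw [isOpen_iff_mem_nhds]
    rintro p ⟨V, hV, hpV, h⟩
    filter_upwards [hV.mem_nhds hpV] with q hq
    exact ⟨V, hV, hq, h⟩
  have hopen : ∀ (p : E) (r : ℝ), IsOpen (L ⁻¹' ball (L p) r) := fun p r =>
    isOpen_ball.preimage L.continuous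
  have hbc : ∀ (p : E) (r : ℝ), L ⁻¹' ball (L p) r ⊆ L ⁻¹' closedBall (L p) r := fun p r =>
    Set.preimage_mono ball_subset_closedBall
  have hp₀A : p₀ ∈ A := by
    refine ⟨_, hopen p₀ r₀, mem_ball_self hr₀, fun g hg => ?_⟩
    exact hmemT g _ (le_sup_right (a := divSpan (coordVec L) W) (Submodule.mem_span_singleton_self _))
      (exists_sub_smul_coordBump_mem_divSpan hr₀ hr₀ hp₀ subset_rfl (hg.mono (hbc _ _)))
  have hcl : closure A ∩ W ⊆ A := by
    rintro p ⟨hpA, hpW⟩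
    obtain ⟨r, hr, hrW⟩ := exists_coordBox_subset L hW hpW
    have hpV : p ∈ L ⁻¹' ball (L p) r := mem_ball_self hr
    obtain ⟨q, hqV, V, hV, hqV', hVT⟩ := mem_closure_iff.1 hpA _ (hopen p r) hpV
    obtain ⟨s, hs, hsV⟩ := exists_coordBox_subset L ((hopen p r).inter hV) ⟨hqV, hqV'⟩
    refine ⟨_, hopen p r, hpV, fun g hg => ?_⟩
    exact hmemT g _ (hVT _ (isTestFn_coordBump hs (hsV.trans Set.inter_subset_right)))
      (exists_sub_smul_coordBump_mem_divSpan hs hr hrW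
        ((hsV.trans Set.inter_subset_left).trans (hbc _ _)) (hg.mono (hbc _ _)))
  have hWA : W ⊆ A := hWc.subset_of_closure_inter_subset hAo
    ⟨p₀, hp₀ (mem_closedBall_self hr₀.le), hp₀A⟩ hcl
  obtain ⟨hf1, K, hK, hKW, hK0⟩ := hf
  have : FiniteDimensional ℝ E := L.symm.toLinearEquiv.finiteDimensional
  choose! V hVo hVp hVT using fun p (hp : p ∈ K) => hWA (hKW hp)
  obtain ⟨t, htK, htc⟩ := hK.elim_nhds_subcover V fun p hp => (hVo p hp).mem_nhds (hVp p hp)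
  obtain ⟨ζ, hζ⟩ := SmoothPartitionOfUnity.exists_isSubordinate (modelWithCornersSelf ℝ E)
    hK.isClosed (fun p : t => V p) (fun p => hVo p (htK p p.2)) (fun x hx => by
      obtain ⟨p, hp, hxp⟩ := Set.mem_iUnion₂.1 (htc hx)
      exact Set.mem_iUnion.2 ⟨⟨p, hp⟩, hxp⟩)
  have hsum : f = ∑ p : t, fun x => (ζ p x : ℂ) * f x := by
    ext x
    rw [Finset.sum_apply]
    by_cases hx : x ∈ K
    · have h1 := ζ.sum_eq_one hx
      rw [finsum_eq_sum_of_fintype] at h1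
      rw [← Finset.sum_mul, ← ofReal_sum, h1]
      simp
    · simp [hK0 x hx]
  rw [hsum]
  refine T.sum_mem fun p _ => hVT p (htK p p.2) _ ⟨?_, K ∩ tsupport (ζ p),
    hK.inter_right (isClosed_tsupport _), Set.inter_subset_right.trans (hζ p), fun x hx => ?_⟩
  · exact (ofRealCLM.contDiff.comp (ζ p).contMDiff.contDiff).mul hf1
  · by_cases hxK : x ∈ K
    · have : ζ p x = 0 := image_eq_zero_of_notMem_tsupport fun h => hx ⟨hxK, h⟩
      simp [this]
    · simp [hK0 x hxK]

end Poincare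

/-! ### Iterated derivatives on phase space and symbol estimates -/

section SymbolBound

variable {n : ℕ}

/-- The coordinate directions of phase space: `inl` for positions, `inr` for momenta. -/
def dirVec : Fin n ⊕ Fin n → Euc n × Euc n
  | .inl i => (EuclideanSpace.single i 1, 0)
  | .inr i => (0, EuclideanSpace.single i 1)

/-- Iterated coordinate derivatives on phase space. -/
def dirIter : List (Fin n ⊕ Fin n) → (Euc n × Euc n → ℂ) → Euc n × Euc n → ℂ
  | [], F => F
  | d :: l, F => dirDeriv (dirVec d) (dirIter l F)

theorem dirIter_append (l l' : List (Fin n ⊕ Fin n)) (F : Euc n × Euc n → ℂ) :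
    dirIter (l ++ l') F = dirIter l (dirIter l' F) := by
  induction l with
  | nil => rfl
  | cons d l ih => simp [dirIter, ih]

theorem ContDiffOn.dirIter {F : Euc n × Euc n → ℂ} {O : Set (Euc n × Euc n)} (hO : IsOpen O)
    (hF : ContDiffOn ℝ ∞ F O) (l : List (Fin n ⊕ Fin n)) : ContDiffOn ℝ ∞ (dirIter l F) O := by
  induction l with
  | nil => exact hF
  | cons d l ih => exact ih.dirDeriv hO _

theorem ContDiff.dirIter {F : Euc n × Euc n → ℂ} (hF : ContDiff ℝ ∞ F)
    (l : List (Fin n ⊕ Fin n)) : ContDiff ℝ ∞ (dirIter l F) := by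
  induction l with
  | nil => exact hF
  | cons d l ih => exact ih.dirDeriv _

theorem dirIter_add {F G : Euc n × Euc n → ℂ} (hF : ContDiff ℝ ∞ F) (hG : ContDiff ℝ ∞ G)
    (l : List (Fin n ⊕ Fin n)) : dirIter l (F + G) = dirIter l F + dirIter l G := by
  induction l with
  | nil => rfl
  | cons d l ih => simp only [dirIter, ih, dirDeriv_add (hF.dirIter l) (hG.dirIter l)]

theorem dirIter_neg (F : Euc n × Euc n → ℂ) (l : List (Fin n ⊕ Fin n)) :
    dirIter l (-F) = -dirIter l F := by
  induction l with
  | nil => rfl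
  | cons d l ih =>
    ext p
    simp [dirIter, ih, dirDeriv, fderiv_neg]

theorem dirIter_eqOn {F G : Euc n × Euc n → ℂ} {O : Set (Euc n × Euc n)} (hO : IsOpen O)
    (h : Set.EqOn F G O) (l : List (Fin n ⊕ Fin n)) :
    Set.EqOn (dirIter l F) (dirIter l G) O := by
  induction l with
  | nil => exact h
  | cons d l ih => exact dirDeriv_eqOn hO ih _

theorem dirIter_eq_zero {F : Euc n × Euc n → ℂ} {O : Set (Euc n × Euc n)} (hO : IsOpen O)
    (h : ∀ p ∈ O, F p = 0) (l : List (Fin n ⊕ Fin n)) : ∀ p ∈ O, dirIter l F p = 0 := by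
  induction l with
  | nil => exact h
  | cons d l ih => exact dirDeriv_eq_zero hO ih _

theorem dirIter_zero (l : List (Fin n ⊕ Fin n)) : dirIter l (0 : Euc n × Euc n → ℂ) = 0 :=
  funext fun p => dirIter_eq_zero isOpen_univ (fun _ _ => rfl) l p trivial

theorem dirDeriv_comm {E : Type*} [NormedAddCommGroup E] [NormedSpace ℝ E] {F : E → ℂ}
    (hF : ContDiff ℝ ∞ F) (v w : E) :
    dirDeriv v (dirDeriv w F) = dirDeriv w (dirDeriv v F) := by
  ext p
  have hd : DifferentiableAt ℝ (fderiv ℝ F) p :=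
    (hF.fderiv_right (m := ∞) (by simp)).differentiable (by simp) p
  have key : ∀ u w : E, dirDeriv u (dirDeriv w F) p = fderiv ℝ (fderiv ℝ F) p u w := by
    intro u w
    unfold dirDeriv
    rw [fderiv_clm_apply hd (differentiableAt_const w)]
    simp
  rw [key, key]
  exact (hF.contDiffAt.isSymmSndFDerivAt (by rw [minSmoothness_of_isRCLikeNormedField]; exact WithTop.coe_le_coe.2 le_top)).eq v w

theorem dirIter_perm {F : Euc n × Euc n → ℂ} (hF : ContDiff ℝ ∞ F)
    {l l' : List (Fin n ⊕ Fin n)} (h : l.Perm l') : dirIter l F = dirIter l' F := by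
  induction h with
  | nil => rfl
  | cons d _ ih => simp [dirIter, ih]
  | swap d d' l => exact dirDeriv_comm (hF.dirIter l) _ _
  | trans _ _ ih ih' => exact ih.trans ih'

theorem pdFst_eq_dirDeriv {F : Euc n × Euc n → ℂ} (hF : Differentiable ℝ F) (i : Fin n) :
    pdFst i (fun x ξ => F (x, ξ)) = fun x ξ => dirDeriv (dirVec (.inl i)) F (x, ξ) := by
  ext x ξ
  have := (hF (x, ξ)).hasFDerivAt.comp x
    ((hasFDerivAt_id (𝕜 := ℝ) x).prodMk (hasFDerivAt_const ξ x))
  simp only [pdFst, dirDeriv, dirVec]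
  exact congrArg (fun T => T (EuclideanSpace.single i 1)) this.fderiv

theorem pdSnd_eq_dirDeriv {F : Euc n × Euc n → ℂ} (hF : Differentiable ℝ F) (i : Fin n) :
    pdSnd i (fun x ξ => F (x, ξ)) = fun x ξ => dirDeriv (dirVec (.inr i)) F (x, ξ) := by
  ext x ξ
  have := (hF (x, ξ)).hasFDerivAt.comp ξ
    ((hasFDerivAt_const x ξ).prodMk (hasFDerivAt_id (𝕜 := ℝ) ξ))
  simp only [pdSnd, dirDeriv, dirVec]
  exact congrArg (fun T => T (EuclideanSpace.single i 1)) this.fderiv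

theorem pdIter_eq_dirIter {F : Euc n × Euc n → ℂ} (hF : ContDiff ℝ ∞ F) (Lξ Lx : List (Fin n)) :
    pdIterSnd Lξ (pdIterFst Lx fun x ξ => F (x, ξ)) =
      fun x ξ => dirIter (Lξ.map .inr ++ Lx.map .inl) F (x, ξ) := by
  have hx : pdIterFst Lx (fun x ξ => F (x, ξ)) = fun x ξ => dirIter (Lx.map .inl) F (x, ξ) := by
    induction Lx with
    | nil => rfl
    | cons i Lx ih =>
      simp only [pdIterFst, ih]
      exact pdFst_eq_dirDeriv ((hF.dirIter _).differentiable (by simp)) i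
  rw [hx]
  induction Lξ with
  | nil => rfl
  | cons i Lξ ih =>
    simp only [pdIterSnd, ih]
    exact pdSnd_eq_dirDeriv ((hF.dirIter _).differentiable (by simp)) i

/-- The number of momentum derivatives in a list of directions. -/
def momentumOrder (l : List (Fin n ⊕ Fin n)) : ℕ := l.countP Sum.isRight

@[simp]
theorem momentumOrder_append (l l' : List (Fin n ⊕ Fin n)) :
    momentumOrder (l ++ l') = momentumOrder l + momentumOrder l' :=
  List.countP_append

theorem momentumOrder_le_length (l : List (Fin n ⊕ Fin n)) : momentumOrder l ≤ l.length :=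
  List.countP_le_length

@[simp]
theorem momentumOrder_map_inr_append_map_inl (Lξ Lx : List (Fin n)) :
    momentumOrder (Lξ.map .inr ++ Lx.map .inl) = Lξ.length := by
  have h1 : momentumOrder (Lξ.map Sum.inr : List (Fin n ⊕ Fin n)) = Lξ.length := by
    simp [momentumOrder, List.countP_map, Function.comp_def]
  have h2 : momentumOrder (Lx.map Sum.inl : List (Fin n ⊕ Fin n)) = 0 := by
    simp [momentumOrder, List.countP_map, Function.comp_def]
  simp [h1, h2]

theorem exists_perm_map_inr_append_map_inl (l : List (Fin n ⊕ Fin n)) :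
    ∃ Lξ Lx : List (Fin n), l.Perm (Lξ.map .inr ++ Lx.map .inl) := by
  induction l with
  | nil => exact ⟨[], [], by simp⟩
  | cons d l ih =>
    obtain ⟨Lξ, Lx, h⟩ := ih
    cases d with
    | inl i => exact ⟨Lξ, i :: Lx, (h.cons _).trans List.perm_middle.symm⟩
    | inr i => exact ⟨i :: Lξ, Lx, h.cons _⟩

/-- A family of functions on phase space satisfying the symbol estimates of order `m`,
uniformly in the parameter. -/
def SymbolBound {ι : Type*} (m : ℝ) (F : ι → Euc n × Euc n → ℂ) : Prop :=
  ∀ l : List (Fin n ⊕ Fin n), ∃ C : ℝ, ∀ i p,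
    ‖dirIter l (F i) p‖ ≤ C * (1 + ‖p.2‖) ^ (m - momentumOrder l)

namespace SymbolBound

variable {ι : Type*} {m m' : ℝ} {F G : ι → Euc n × Euc n → ℂ}

theorem mono (hF : SymbolBound m F) (h : m ≤ m') : SymbolBound m' F := by
  intro l
  obtain ⟨C, hC⟩ := hF l
  refine ⟨max C 0, fun i p => (hC i p).trans ?_⟩
  have h1 : 1 ≤ 1 + ‖p.2‖ := by linarith [norm_nonneg p.2]
  have h2 := le_max_right C 0
  have h3 : C ≤ max C 0 := le_max_left C 0
  gcongr

theorem add (hFs : ∀ i, ContDiff ℝ ∞ (F i)) (hGs : ∀ i, ContDiff ℝ ∞ (G i))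
    (hF : SymbolBound m F) (hG : SymbolBound m G) : SymbolBound m (fun i => F i + G i) := by
  intro l
  obtain ⟨C, hC⟩ := hF l
  obtain ⟨D, hD⟩ := hG l
  refine ⟨C + D, fun i p => ?_⟩
  rw [dirIter_add (hFs i) (hGs i), add_mul]
  exact (norm_add_le _ _).trans (add_le_add (hC i p) (hD i p))

theorem neg (hF : SymbolBound m F) : SymbolBound m (fun i => -F i) := by
  intro l
  obtain ⟨C, hC⟩ := hF l
  refine ⟨C, fun i p => ?_⟩
  rw [dirIter_neg, Pi.neg_apply, norm_neg]
  exact hC i p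

theorem dirDeriv (hF : SymbolBound m F) (d : Fin n ⊕ Fin n) :
    SymbolBound (m - momentumOrder [d]) (fun i => dirDeriv (dirVec d) (F i)) := by
  intro l
  obtain ⟨C, hC⟩ := hF (l ++ [d])
  refine ⟨C, fun i p => ?_⟩
  have := hC i p
  rw [dirIter_append, momentumOrder_append, Nat.cast_add] at this
  refine this.trans_eq ?_
  congr 2
  ring

theorem mul (hFs : ∀ i, ContDiff ℝ ∞ (F i)) (hGs : ∀ i, ContDiff ℝ ∞ (G i))
    (hF : SymbolBound m F) (hG : SymbolBound m' G) :
    SymbolBound (m + m') (fun i p => F i p * G i p) := by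
  intro l
  induction l using List.reverseRecOn generalizing m m' F G with
  | nil =>
    obtain ⟨C, hC⟩ := hF []
    obtain ⟨D, hD⟩ := hG []
    refine ⟨C * D, fun i p => ?_⟩
    have h1 : 0 < 1 + ‖p.2‖ := by linarith [norm_nonneg p.2]
    have := mul_le_mul (hC i p) (hD i p) (norm_nonneg _) ((norm_nonneg _).trans (hC i p))
    simp only [dirIter, norm_mul] at this ⊢
    refine this.trans_eq ?_
    simp only [momentumOrder, List.countP_nil, Nat.cast_zero, sub_zero, Real.rpow_add h1]
    ring
  | append_singleton l d ih =>
    obtain ⟨C, hC⟩ := ih (fun i => (hFs i).dirDeriv (dirVec d)) hGs (hF.dirDeriv d) hG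
    obtain ⟨D, hD⟩ := ih hFs (fun i => (hGs i).dirDeriv (dirVec d)) hF (hG.dirDeriv d)
    refine ⟨C + D, fun i p => ?_⟩
    have hsplit : _root_.dirDeriv (dirVec d) (fun p => F i p * G i p) =
        (fun p => _root_.dirDeriv (dirVec d) (F i) p * G i p) +
          fun p => F i p * _root_.dirDeriv (dirVec d) (G i) p := by
      ext p
      exact dirDeriv_mul_apply ((hFs i).differentiable (by simp) p)
        ((hGs i).differentiable (by simp) p) _
    rw [dirIter_append, show dirIter [d] (fun p => F i p * G i p) = _ from hsplit,
      dirIter_add (((hFs i).dirDeriv _).mul (hGs i)) ((hFs i).mul ((hGs i).dirDeriv _)),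
      add_mul, momentumOrder_append, Nat.cast_add]
    refine (norm_add_le _ _).trans (add_le_add ?_ ?_)
    · refine (hC i p).trans_eq ?_
      congr 2
      ring
    · refine (hD i p).trans_eq ?_
      congr 2
      ring

end SymbolBound

theorem symbolBound_of_compact_support {F : Euc n × Euc n → ℂ} (hF : ContDiff ℝ ∞ F)
    (hFc : HasCompactSupport F) (m : ℝ) : SymbolBound m (fun _ : Unit => F) := by
  intro l
  have hc : HasCompactSupport (dirIter l F) := by
    induction l with
    | nil => exact hFc
    | cons d l ih => exact ih.dirDeriv _
  have h1 : ∀ p : Euc n × Euc n, 0 < 1 + ‖p.2‖ := fun p => by linarith [norm_nonneg p.2]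
  obtain ⟨C, hC⟩ := (HasCompactSupport.mul_right (f := dirIter l F)
    (f' := fun p => (((1 + ‖p.2‖) ^ (-(m - momentumOrder l)) : ℝ) : ℂ)) hc).exists_bound_of_continuous
      ((hF.dirIter l).continuous.mul (continuous_ofReal.comp
        ((by fun_prop : Continuous fun p : Euc n × Euc n => 1 + ‖p.2‖).rpow_const
          fun p => Or.inl (h1 p).ne')))
  refine ⟨C, fun _ p => ?_⟩
  have := hC p
  rw [Pi.mul_apply, norm_mul, norm_real, Real.norm_of_nonneg (by positivity),
    Real.rpow_neg (h1 p).le, ← div_eq_mul_inv, div_le_iff₀ (by have := h1 p; positivity)] at this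
  exact this

end SymbolBound

/-! ### Homogeneous functions and classical symbols on phase space -/

section Homogeneous

variable {n : ℕ} {U : Set (Euc n)} {χ : Euc n → ℝ} {a b : ℂ} {h : Euc n × Euc n → ℂ}

/-- A smooth function on `U × (ℝⁿ ∖ 0)`, compactly supported in the position, and positively
homogeneous of degree `b` in the momentum. -/
structure IsHom (U : Set (Euc n)) (b : ℂ) (h : Euc n × Euc n → ℂ) : Prop where
  smooth : ContDiffOn ℝ ∞ h {p | p.2 ≠ 0}
  supp : ∃ K, IsCompact K ∧ K ⊆ U ∧ ∀ x ∉ K, ∀ ξ, h (x, ξ) = 0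
  homog : ∀ t : ℝ, 0 < t → ∀ x ξ, ξ ≠ 0 → h (x, t • ξ) = (t : ℂ) ^ b * h (x, ξ)

theorem isOpen_momentum_ne_zero : IsOpen {p : Euc n × Euc n | p.2 ≠ 0} :=
  isOpen_ne_fun continuous_snd continuous_const

theorem dirDeriv_comp_clm {F : Euc n × Euc n → ℂ} (S : Euc n × Euc n →L[ℝ] Euc n × Euc n)
    {p : Euc n × Euc n} (hF : DifferentiableAt ℝ F (S p)) (v : Euc n × Euc n) :
    dirDeriv v (fun q => F (S q)) p = dirDeriv (S v) F (S p) := by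
  unfold dirDeriv
  exact congrArg (fun T => T v) (hF.hasFDerivAt.comp p S.hasFDerivAt).fderiv

/-- Scaling of the momentum variable. -/
def momentumScale (t : ℝ) : Euc n × Euc n →L[ℝ] Euc n × Euc n :=
  (ContinuousLinearMap.id ℝ (Euc n)).prodMap (t • ContinuousLinearMap.id ℝ (Euc n))

@[simp]
theorem momentumScale_apply (t : ℝ) (p : Euc n × Euc n) : momentumScale t p = (p.1, t • p.2) := rfl

theorem momentumScale_dirVec (t : ℝ) (d : Fin n ⊕ Fin n) :
    momentumScale t (dirVec d) = t ^ momentumOrder [d] • dirVec d := by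
  cases d <;> simp [dirVec, momentumOrder]

theorem IsHom.dirDeriv (hh : IsHom U b h) (d : Fin n ⊕ Fin n) :
    IsHom U (b - momentumOrder [d]) (dirDeriv (dirVec d) h) where
  smooth := hh.smooth.dirDeriv isOpen_momentum_ne_zero _
  supp := by
    obtain ⟨K, hK, hKU, h0⟩ := hh.supp
    refine ⟨K, hK, hKU, fun x hx ξ => ?_⟩
    exact dirDeriv_eq_zero (hK.isClosed.isOpen_compl.preimage continuous_fst)
      (fun p hp => h0 p.1 hp p.2) _ (x, ξ) hx
  homog t ht x ξ hξ := by
    have hS : DifferentiableAt ℝ h (momentumScale t (x, ξ)) :=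
      (hh.smooth.contDiffAt (isOpen_momentum_ne_zero.mem_nhds
        (smul_ne_zero ht.ne' hξ))).differentiableAt (by simp)
    have hd : DifferentiableAt ℝ h (x, ξ) :=
      (hh.smooth.contDiffAt (isOpen_momentum_ne_zero.mem_nhds hξ)).differentiableAt (by simp)
    have h1 := dirDeriv_comp_clm (momentumScale t) hS (dirVec d)
    have h2 : _root_.dirDeriv (dirVec d) (fun q => h (momentumScale t q)) (x, ξ) =
        (t : ℂ) ^ b * _root_.dirDeriv (dirVec d) h (x, ξ) := by
      have := dirDeriv_eqOn (F := fun q => h (momentumScale t q))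
        (G := fun q => (t : ℂ) ^ b * h q) isOpen_momentum_ne_zero
        (fun q hq => hh.homog t ht q.1 q.2 hq) (dirVec d) (x := (x, ξ)) hξ
      rw [this]
      unfold _root_.dirDeriv
      rw [fderiv_const_mul hd]
      rfl
    rw [h2, momentumScale_dirVec] at h1
    have ht' : (t : ℂ) ≠ 0 := ofReal_ne_zero.2 ht.ne'
    rw [cpow_sub _ _ ht', cpow_natCast, div_mul_eq_mul_div, eq_div_iff (pow_ne_zero _ ht'), h1]
    simp [_root_.dirDeriv, mul_comm]

theorem IsHom.dirIter (hh : IsHom U b h) (l : List (Fin n ⊕ Fin n)) :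
    IsHom U (b - momentumOrder l) (dirIter l h) := by
  induction l with
  | nil => simpa [momentumOrder, _root_.dirIter] using hh
  | cons d l ih =>
    have := ih.dirDeriv d
    have e : b - momentumOrder l - momentumOrder [d] = b - momentumOrder (d :: l) := by
      rw [show d :: l = [d] ++ l from rfl, momentumOrder_append]
      push_cast
      ring
    rwa [e] at this

theorem IsHom.smul (hh : IsHom U b h) (c : ℂ) : IsHom U b (c • h) where
  smooth := contDiffOn_const.smul hh.smooth
  supp := by
    obtain ⟨K, hK, hKU, h0⟩ := hh.supp
    exact ⟨K, hK, hKU, fun x hx ξ => by simp [h0 x hx ξ]⟩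
  homog t ht x ξ hξ := by
    simp only [Pi.smul_apply, smul_eq_mul, hh.homog t ht x ξ hξ]
    ring

theorem IsHom.zero : IsHom U b (0 : Euc n × Euc n → ℂ) where
  smooth := contDiffOn_const
  supp := ⟨∅, isCompact_empty, Set.empty_subset _, fun _ _ _ => rfl⟩
  homog _ _ _ _ _ := by simp

theorem IsHom.add {h' : Euc n × Euc n → ℂ} (hh : IsHom U b h) (hh' : IsHom U b h') :
    IsHom U b (h + h') where
  smooth := hh.smooth.add hh'.smooth
  supp := by
    obtain ⟨K, hK, hKU, h0⟩ := hh.supp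
    obtain ⟨K', hK', hKU', h0'⟩ := hh'.supp
    refine ⟨K ∪ K', hK.union hK', Set.union_subset hKU hKU', fun x hx ξ => ?_⟩
    rw [Set.mem_union, not_or] at hx
    simp [h0 x hx.1, h0' x hx.2]
  homog t ht x ξ hξ := by
    simp only [Pi.add_apply, hh.homog t ht x ξ hξ, hh'.homog t ht x ξ hξ]
    ring

theorem IsHom.coord_mul (hh : IsHom U b h) (i : Fin n) :
    IsHom U (b + 1) (fun p => (p.2 i : ℂ) * h p) where
  smooth := (ofRealCLM.contDiff.comp
    ((EuclideanSpace.proj (𝕜 := ℝ) i).contDiff.comp contDiff_snd)).contDiffOn.mul hh.smooth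
  supp := by
    obtain ⟨K, hK, hKU, h0⟩ := hh.supp
    exact ⟨K, hK, hKU, fun x hx ξ => by simp [h0 x hx ξ]⟩
  homog t ht x ξ hξ := by
    simp only [hh.homog t ht x ξ hξ, cpow_add _ _ (ofReal_ne_zero.2 ht.ne'), cpow_one,
      PiLp.smul_apply, smul_eq_mul, ofReal_mul]
    ring

/-- Multiplication by a cut-off function in the momentum. -/
def cut (χ : Euc n → ℝ) (h : Euc n × Euc n → ℂ) : Euc n × Euc n → ℂ :=
  fun p => (χ p.2 : ℂ) * h p

theorem contDiff_cut (hχ : IsCutoff χ) (hh : ContDiffOn ℝ ∞ h {p | p.2 ≠ 0}) :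
    ContDiff ℝ ∞ (cut χ h) := by
  obtain ⟨ε, hε, h0⟩ := hχ.zero_near
  refine contDiff_iff_contDiffAt.2 fun p => ?_
  by_cases hp : p.2 = 0
  · have : cut χ h =ᶠ[𝓝 p] fun _ => 0 := by
      have ho : IsOpen {q : Euc n × Euc n | ‖q.2‖ < ε} :=
        isOpen_lt continuous_snd.norm continuous_const
      filter_upwards [ho.mem_nhds (x := p) (by simpa [hp] using hε)] with q hq
      simp [cut, h0 q.2 hq]
    exact contDiffAt_const.congr_of_eventuallyEq this
  · exact (ofRealCLM.contDiff.comp (hχ.smooth.comp contDiff_snd)).contDiffAt.mul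
      (hh.contDiffAt (isOpen_momentum_ne_zero.mem_nhds hp))

theorem cut_eqOn (hχ : IsCutoff χ) (h : Euc n × Euc n → ℂ) :
    Set.EqOn (cut χ h) h {p | 1 < ‖p.2‖} := fun p hp => by
  simp [cut, hχ.one_far p.2 (le_of_lt hp)]

theorem isOpen_one_lt_norm_momentum : IsOpen {p : Euc n × Euc n | 1 < ‖p.2‖} :=
  isOpen_lt continuous_const continuous_snd.norm

theorem IsHom.exists_bound (hh : IsHom U b h) :
    ∃ C : ℝ, ∀ p : Euc n × Euc n, p.2 ≠ 0 → ‖h p‖ ≤ C * ‖p.2‖ ^ b.re := by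
  obtain ⟨K, hK, -, h0⟩ := hh.supp
  have hc : ContinuousOn h (K ×ˢ sphere (0 : Euc n) 1) :=
    hh.smooth.continuousOn.mono fun p hp => by
      have : ‖p.2‖ = 1 := by simpa using hp.2
      exact fun h0 => by simp [h0] at this
  obtain ⟨C, hC⟩ := (hK.prod (isCompact_sphere (0 : Euc n) 1)).exists_bound_of_continuousOn hc
  refine ⟨max C 0, fun p hp => ?_⟩
  have hp' : 0 < ‖p.2‖ := norm_pos_iff.2 hp
  have hb : 0 ≤ ‖p.2‖ ^ b.re := by positivity
  by_cases hx : p.1 ∈ K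
  · have h1 := hC (p.1, ‖p.2‖⁻¹ • p.2) ⟨hx, by simp [norm_smul, hp'.ne']⟩
    have h2 := hh.homog ‖p.2‖ hp' p.1 (‖p.2‖⁻¹ • p.2) (smul_ne_zero (inv_ne_zero hp'.ne') hp)
    rw [smul_smul, mul_inv_cancel₀ hp'.ne', one_smul] at h2
    rw [show h p = h (p.1, p.2) from rfl, h2, norm_mul, norm_cpow_eq_rpow_re_of_pos hp', mul_comm]
    exact mul_le_mul_of_nonneg_right (h1.trans (le_max_left _ _)) hb
  · rw [show h p = h (p.1, p.2) from rfl, h0 p.1 hx, norm_zero]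
    have := le_max_right C 0
    positivity

theorem rpow_norm_le {x : ℝ} (hx : 1 ≤ x) (s : ℝ) : x ^ s ≤ 2 ^ |s| * (1 + x) ^ s := by
  have hx0 : 0 < x := by linarith
  rcases le_total 0 s with hs | hs
  · have h1 : (1 : ℝ) ≤ 2 ^ |s| := Real.one_le_rpow (by norm_num) (abs_nonneg s)
    calc x ^ s ≤ (1 + x) ^ s := by gcongr; linarith
      _ ≤ 2 ^ |s| * (1 + x) ^ s := le_mul_of_one_le_left (by positivity) h1
  · have h1 : (2 * x) ^ s ≤ (1 + x) ^ s :=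
      Real.rpow_le_rpow_of_nonpos (by linarith) (by linarith) hs
    rw [Real.mul_rpow (by norm_num) hx0.le] at h1
    calc x ^ s = 2 ^ |s| * (2 ^ s * x ^ s) := by
          rw [← mul_assoc, ← Real.rpow_add (by norm_num), abs_of_nonpos hs]
          simp
      _ ≤ 2 ^ |s| * (1 + x) ^ s := by gcongr

theorem IsHom.symbolBound_cut (hχ : IsCutoff χ) (hh : IsHom U b h) :
    SymbolBound b.re (fun _ : Unit => cut χ h) := by
  intro l
  have hs := (contDiff_cut hχ hh.smooth).dirIter l
  obtain ⟨C, hC⟩ := (hh.dirIter l).exists_bound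
  obtain ⟨K, hK, -, h0⟩ := hh.supp
  set s : ℝ := b.re - momentumOrder l with hsdef
  have h1 : ∀ p : Euc n × Euc n, 0 < 1 + ‖p.2‖ := fun p => by linarith [norm_nonneg p.2]
  have hcont : Continuous fun p : Euc n × Euc n => _root_.dirIter l (cut χ h) p * (((1 + ‖p.2‖) ^ (-s) : ℝ) : ℂ) :=
    hs.continuous.mul (continuous_ofReal.comp
        ((by fun_prop : Continuous fun p : Euc n × Euc n => 1 + ‖p.2‖).rpow_const
          fun p => Or.inl (h1 p).ne'))
  obtain ⟨D, hD⟩ := (hK.prod (isCompact_closedBall (0 : Euc n) 1)).exists_bound_of_continuousOn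
    hcont.continuousOn
  refine ⟨max (|C| * 2 ^ |s|) (max D 0), fun _ p => ?_⟩
  have hpos : 0 ≤ (1 + ‖p.2‖) ^ s := by have := h1 p; positivity
  by_cases hp : 1 < ‖p.2‖
  · have hp0 : p.2 ≠ 0 := norm_pos_iff.1 (by linarith)
    rw [dirIter_eqOn isOpen_one_lt_norm_momentum (cut_eqOn hχ h) l hp]
    have := hC p hp0
    rw [show (b - (momentumOrder l : ℂ)).re = s by simp [hsdef]] at this
    calc _ ≤ |C| * ‖p.2‖ ^ s := this.trans (by gcongr; exact le_abs_self C)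
      _ ≤ |C| * (2 ^ |s| * (1 + ‖p.2‖) ^ s) := by gcongr; exact rpow_norm_le hp.le s
      _ ≤ _ := by rw [← mul_assoc]; gcongr; exact le_max_left _ _
  · by_cases hx : p.1 ∈ K
    · have := hD p ⟨hx, by simpa using not_lt.1 hp⟩
      rw [norm_mul, norm_real, Real.norm_of_nonneg (by have := h1 p; positivity),
        Real.rpow_neg (h1 p).le, ← div_eq_mul_inv,
        div_le_iff₀ (by have := h1 p; positivity)] at this
      refine this.trans ?_
      gcongr
      exact (le_max_left _ _).trans (le_max_right _ _)
    · rw [dirIter_eq_zero (hK.isClosed.isOpen_compl.preimage continuous_fst)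
        (fun p hp => by simp [cut, show h p = 0 from h0 p.1 hp p.2]) l p hx, norm_zero]
      have : 0 ≤ max (|C| * 2 ^ |s|) (max D 0) := (le_max_right D 0).trans (le_max_right _ _)
      positivity

end Homogeneous

section ClassicalSymbol

variable {n : ℕ} {U : Set (Euc n)} {χ : Euc n → ℝ} {a : ℂ} {F G : Euc n × Euc n → ℂ}
  {c c' : ℕ → Euc n × Euc n → ℂ}

/-- Classical symbols with compact support in `U`, as functions on phase space. -/
structure IsSym (U : Set (Euc n)) (χ : Euc n → ℝ) (a : ℂ) (F : Euc n × Euc n → ℂ)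
    (c : ℕ → Euc n × Euc n → ℂ) : Prop where
  smooth : ContDiff ℝ ∞ F
  supp : ∃ K, IsCompact K ∧ K ⊆ U ∧ ∀ x ∉ K, ∀ ξ, F (x, ξ) = 0 ∧ ∀ j, c j (x, ξ) = 0
  comp_smooth : ∀ j, ContDiffOn ℝ ∞ (c j) {p | p.2 ≠ 0}
  comp_homog : ∀ j (t : ℝ), 0 < t → ∀ x ξ, ξ ≠ 0 →
    c j (x, t • ξ) = (t : ℂ) ^ (a - j) * c j (x, ξ)
  estimate : ∀ N : ℕ,
    SymbolBound (a.re - N) (fun _ : Unit => F - ∑ j ∈ Finset.range N, cut χ (c j))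

theorem IsSym.isHom (hF : IsSym U χ a F c) (j : ℕ) : IsHom U (a - j) (c j) where
  smooth := hF.comp_smooth j
  supp := by
    obtain ⟨K, hK, hKU, h0⟩ := hF.supp
    exact ⟨K, hK, hKU, fun x hx ξ => (h0 x hx ξ).2 j⟩
  homog := hF.comp_homog j

theorem contDiff_sub_sum_cut (hχ : IsCutoff χ) (hF : ContDiff ℝ ∞ F)
    (hc : ∀ j, ContDiffOn ℝ ∞ (c j) {p | p.2 ≠ 0}) (N : ℕ) :
    ContDiff ℝ ∞ (F - ∑ j ∈ Finset.range N, cut χ (c j)) := by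
  have : (F - ∑ j ∈ Finset.range N, cut χ (c j)) =
      fun p => F p - ∑ j ∈ Finset.range N, cut χ (c j) p := by
    ext p
    simp
  rw [this]
  exact hF.sub (ContDiff.sum fun j _ => contDiff_cut hχ (hc j))

theorem IsSym.isCSCpt (hχ : IsCutoff χ) (hF : IsSym U χ a F c) :
    IsCSCpt U χ a (fun x ξ => F (x, ξ)) (fun j x ξ => c j (x, ξ)) where
  smooth := hF.smooth
  supp := by
    obtain ⟨K, hK, hKU, h0⟩ := hF.supp
    exact ⟨K, hK, hKU, fun x hx => ⟨fun ξ => (h0 x hx ξ).1, fun j ξ => (h0 x hx ξ).2 j⟩⟩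
  comp_smooth := hF.comp_smooth
  comp_homog := hF.comp_homog
  estimate N Lξ Lx := by
    obtain ⟨C, hC⟩ := hF.estimate N (Lξ.map .inr ++ Lx.map .inl)
    refine ⟨max C 1, by positivity, fun x ξ => ?_⟩
    have h1 := pdIter_eq_dirIter
      (contDiff_sub_sum_cut hχ hF.smooth hF.comp_smooth N) Lξ Lx
    have h2 := hC () (x, ξ)
    rw [← congrFun (congrFun h1 x) ξ, momentumOrder_map_inr_append_map_inl] at h2
    simp only [Pi.sub_apply, Finset.sum_apply, cut] at h2
    have h3 := le_max_left C 1
    exact h2.trans (by gcongr)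

theorem IsCSCpt.isSym (hχ : IsCutoff χ) {σ : Euc n → Euc n → ℂ} {σc : ℕ → Euc n → Euc n → ℂ}
    (hσ : IsCSCpt U χ a σ σc) :
    IsSym U χ a (fun p => σ p.1 p.2) (fun j p => σc j p.1 p.2) where
  smooth := hσ.smooth
  supp := by
    obtain ⟨K, hK, hKU, h0⟩ := hσ.supp
    exact ⟨K, hK, hKU, fun x hx ξ => ⟨(h0 x hx).1 ξ, fun j => (h0 x hx).2 j ξ⟩⟩
  comp_smooth := hσ.comp_smooth
  comp_homog := hσ.comp_homog
  estimate N l := by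
    have hs := contDiff_sub_sum_cut (c := fun j p => σc j p.1 p.2) hχ hσ.smooth hσ.comp_smooth N
    obtain ⟨Lξ, Lx, hl⟩ := exists_perm_map_inr_append_map_inl l
    obtain ⟨C, -, hC⟩ := hσ.estimate N Lξ Lx
    refine ⟨C, fun _ p => ?_⟩
    have h1 := pdIter_eq_dirIter hs Lξ Lx
    have h2 := hC p.1 p.2
    rw [dirIter_perm hs hl, show momentumOrder l = Lξ.length from
      (hl.countP_eq _).trans (momentumOrder_map_inr_append_map_inl Lξ Lx)]
    refine le_trans (le_of_eq ?_) h2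
    rw [← congrFun (congrFun h1 p.1) p.2]
    simp only [Pi.sub_apply, Finset.sum_apply, cut]

theorem IsSym.add (hχ : IsCutoff χ) (hF : IsSym U χ a F c) (hG : IsSym U χ a G c') :
    IsSym U χ a (F + G) (c + c') where
  smooth := hF.smooth.add hG.smooth
  supp := by
    obtain ⟨K, hK, hKU, h0⟩ := hF.supp
    obtain ⟨K', hK', hKU', h0'⟩ := hG.supp
    refine ⟨K ∪ K', hK.union hK', Set.union_subset hKU hKU', fun x hx ξ => ?_⟩
    rw [Set.mem_union, not_or] at hx
    simp [h0 x hx.1 ξ, h0' x hx.2 ξ]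
  comp_smooth j := (hF.comp_smooth j).add (hG.comp_smooth j)
  comp_homog j := ((hF.isHom j).add (hG.isHom j)).homog
  estimate N := by
    have := SymbolBound.add
      (fun _ => contDiff_sub_sum_cut hχ hF.smooth hF.comp_smooth N)
      (fun _ => contDiff_sub_sum_cut hχ hG.smooth hG.comp_smooth N)
      (hF.estimate N) (hG.estimate N)
    convert this using 2
    ext p
    simp [cut, mul_add, Finset.sum_add_distrib]
    ring

theorem IsHom.isSym_cut (hχ : IsCutoff χ) {h : Euc n × Euc n → ℂ} {j : ℕ}
    (hh : IsHom U (a - j) h) : IsSym U χ a (cut χ h) (Pi.single j h) where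
  smooth := contDiff_cut hχ hh.smooth
  supp := by
    obtain ⟨K, hK, hKU, h0⟩ := hh.supp
    refine ⟨K, hK, hKU, fun x hx ξ => ⟨by simp [cut, h0 x hx ξ], fun i => ?_⟩⟩
    by_cases hi : i = j
    · subst hi
      simp [h0 x hx ξ]
    · simp [Pi.single_eq_of_ne hi]
  comp_smooth i := by
    by_cases hi : i = j
    · subst hi
      simpa using hh.smooth
    · rw [Pi.single_eq_of_ne hi]
      exact contDiffOn_const
  comp_homog i := by
    by_cases hi : i = j
    · subst hi
      simpa using hh.homog
    · simp [Pi.single_eq_of_ne hi]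
  estimate N := by
    have h0 : ∀ i ≠ j, cut χ ((Pi.single j h : ℕ → Euc n × Euc n → ℂ) i) = 0 := by
      intro i hi
      ext p
      simp [cut, Pi.single_eq_of_ne hi]
    by_cases hj : j < N
    · rw [Finset.sum_eq_single_of_mem j (Finset.mem_range.2 hj) fun i _ hi => h0 i hi,
        Pi.single_eq_same, sub_self]
      exact fun l => ⟨0, fun _ p => by simp [dirIter_zero]⟩
    · rw [Finset.sum_eq_zero fun i hi => h0 i (by have := Finset.mem_range.1 hi; omega), sub_zero]
      refine (hh.symbolBound_cut hχ).mono ?_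
      have : (N : ℝ) ≤ j := by exact_mod_cast not_lt.1 hj
      simp only [sub_re, natCast_re]
      linarith

theorem IsTestFn.isSym {g : Euc n × Euc n → ℂ} (hg : IsTestFn (U ×ˢ Set.univ) g) :
    IsSym U χ a g 0 where
  smooth := hg.1
  supp := by
    obtain ⟨-, K, hK, hKU, h0⟩ := hg
    refine ⟨Prod.fst '' K, hK.image continuous_fst, ?_, fun x hx ξ => ⟨h0 _ fun h => hx ⟨_, h, rfl⟩,
      fun _ => rfl⟩⟩
    rintro _ ⟨p, hp, rfl⟩
    exact (hKU hp).1
  comp_smooth _ := contDiffOn_const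
  comp_homog _ _ _ _ _ _ := by simp
  estimate N := by
    have : ∑ j ∈ Finset.range N, cut χ ((0 : ℕ → Euc n × Euc n → ℂ) j) = 0 :=
      Finset.sum_eq_zero fun j _ => by ext p; simp [cut]
    rw [this, sub_zero]
    exact symbolBound_of_compact_support hg.1 hg.hasCompactSupport _

theorem IsTestFn.isSmoothingCpt {g : Euc n × Euc n → ℂ} (hg : IsTestFn (U ×ˢ Set.univ) g) :
    IsSmoothingCpt U (fun x ξ => g (x, ξ)) := by
  refine ⟨hg.1, ?_, fun Lξ Lx M _ => ?_⟩
  · obtain ⟨K, hK, hKU, h0⟩ := (hg.isSym (χ := 0) (a := 0)).supp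
    exact ⟨K, hK, hKU, fun x hx ξ => (h0 x hx ξ).1⟩
  · obtain ⟨C, hC⟩ := symbolBound_of_compact_support hg.1 hg.hasCompactSupport (Lξ.length - M)
      (Lξ.map .inr ++ Lx.map .inl)
    refine ⟨max C 1, by positivity, fun x ξ => ?_⟩
    have h2 := hC () (x, ξ)
    rw [momentumOrder_map_inr_append_map_inl, sub_sub_cancel_left] at h2
    rw [pdIter_eq_dirIter hg.1]
    have h3 := le_max_left C 1
    exact h2.trans (by gcongr)

end ClassicalSymbol

/-! ### Truncated symbols -/

section Truncation

variable {n : ℕ} {U : Set (Euc n)} {χ : Euc n → ℝ} {a : ℂ} {F : Euc n × Euc n → ℂ}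
  {c : ℕ → Euc n × Euc n → ℂ}

/-- The cut-off function at scale `r` in the momentum. -/
def scaledCutoff (χ : Euc n → ℝ) (r : ℝ) : Euc n × Euc n → ℂ := fun p => (χ (r⁻¹ • p.2) : ℂ)

theorem contDiff_scaledCutoff (hχ : IsCutoff χ) (r : ℝ) : ContDiff ℝ ∞ (scaledCutoff χ r) :=
  ofRealCLM.contDiff.comp (hχ.smooth.comp (contDiff_snd.const_smul r⁻¹))

theorem dirIter_comp_smul {G : Euc n × Euc n → ℂ} (hG : ContDiff ℝ ∞ G) (s : ℝ)
    (l : List (Fin n ⊕ Fin n)) (p : Euc n × Euc n) :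
    dirIter l (fun q => G (s • q)) p = (s : ℂ) ^ l.length * dirIter l G (s • p) := by
  induction l generalizing p with
  | nil => simp [dirIter]
  | cons d l ih =>
    have hd := (hG.dirIter l).differentiable (by simp)
    have h1 : dirIter l (fun q => G (s • q)) =
        fun p => (s : ℂ) ^ l.length * dirIter l G (s • p) := funext ih
    have h2 := dirDeriv_comp_clm (s • ContinuousLinearMap.id ℝ (Euc n × Euc n))
      (hd (s • p)) (dirVec d)
    have h3 : DifferentiableAt ℝ (fun p => dirIter l G (s • p)) p :=
      (hd (s • p)).comp p (differentiableAt_id.const_smul s)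
    simp only [dirIter, h1, List.length_cons, pow_succ]
    have h4 : dirDeriv (dirVec d) (fun p => (s : ℂ) ^ l.length * dirIter l G (s • p)) p =
        (s : ℂ) ^ l.length * dirDeriv (dirVec d) (fun p => dirIter l G (s • p)) p := by
      unfold dirDeriv
      rw [fderiv_const_mul h3]
      rfl
    rw [h4, mul_assoc]
    congr 1
    refine h2.trans ?_
    simp [dirDeriv]

theorem dirIter_translate {G : Euc n × Euc n → ℂ} (y : Euc n × Euc n)
    (hG : ∀ p, G (p + y) = G p) (l : List (Fin n ⊕ Fin n)) (p : Euc n × Euc n) :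
    dirIter l G (p + y) = dirIter l G p := by
  induction l generalizing p with
  | nil => exact hG p
  | cons d l ih =>
    simp only [dirIter, dirDeriv]
    rw [← fderiv_comp_add_right, show (fun x => dirIter l G (x + y)) = dirIter l G from funext ih]

theorem exists_bound_dirIter_scaledCutoff_one (hχ : IsCutoff χ) (l : List (Fin n ⊕ Fin n)) :
    ∃ C : ℝ, ∀ p, ‖dirIter l (scaledCutoff χ 1) p‖ ≤ C ∧
      (l ≠ [] → 1 < ‖p.2‖ → dirIter l (scaledCutoff χ 1) p = 0) := by
  have hcont := ((contDiff_scaledCutoff hχ 1).dirIter l).continuous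
  obtain ⟨C, hC⟩ := (isCompact_singleton (x := (0 : Euc n)).prod
    (isCompact_closedBall (0 : Euc n) 1)).exists_bound_of_continuousOn hcont.continuousOn
  have hone : Set.EqOn (scaledCutoff χ 1) (fun _ => 1) {p | 1 < ‖p.2‖} := fun p hp => by
    simp [scaledCutoff, hχ.one_far p.2 (le_of_lt hp)]
  have hzero : l ≠ [] → ∀ p : Euc n × Euc n, 1 < ‖p.2‖ →
      dirIter l (scaledCutoff χ 1) p = 0 := by
    intro hl p hp
    obtain ⟨l', d, rfl⟩ := List.eq_nil_or_concat'  l |>.resolve_left hl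
    rw [dirIter_append]
    refine dirIter_eq_zero isOpen_one_lt_norm_momentum (fun q hq => ?_) l' p hp
    rw [dirIter, dirIter, dirDeriv_eqOn isOpen_one_lt_norm_momentum hone _ hq]
    simp [dirDeriv]
  refine ⟨max C 1, fun p => ⟨?_, fun hl => hzero hl p⟩⟩
  by_cases hp : 1 < ‖p.2‖
  · by_cases hl : l = []
    · subst hl
      rw [dirIter, hone hp, norm_one]
      exact le_max_right _ _
    · rw [hzero hl p hp, norm_zero]
      exact zero_le_one.trans (le_max_right _ _)
  · have h1 := dirIter_translate (G := scaledCutoff χ 1) (p.1, 0)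
      (fun q => by simp [scaledCutoff]) l (0, p.2)
    have h2 : ((0, p.2) + (p.1, 0) : Euc n × Euc n) = p := by simp
    rw [h2] at h1
    rw [h1]
    exact (hC (0, p.2) ⟨rfl, by simpa using not_lt.1 hp⟩).trans (le_max_left _ _)

theorem symbolBound_scaledCutoff (hχ : IsCutoff χ) :
    SymbolBound 0 (fun r : Set.Ici (1 : ℝ) => scaledCutoff χ (r : ℝ)) := by
  intro l
  obtain ⟨C, hC⟩ := exists_bound_dirIter_scaledCutoff_one hχ l
  have hC0 : 0 ≤ C := (norm_nonneg _).trans (hC 0).1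
  refine ⟨C * 2 ^ l.length, fun ⟨r, hr⟩ p => ?_⟩
  rw [Set.mem_Ici] at hr
  have hr0 : 0 < r := by linarith
  have h1 : 0 < 1 + ‖p.2‖ := by linarith [norm_nonneg p.2]
  have heq : scaledCutoff χ r = fun q => scaledCutoff χ 1 (r⁻¹ • q) := by
    ext q
    simp [scaledCutoff]
  simp only
  rw [heq, dirIter_comp_smul (contDiff_scaledCutoff hχ 1), norm_mul, norm_pow, norm_real,
    Real.norm_of_nonneg (by positivity), zero_sub, Real.rpow_neg h1.le, Real.rpow_natCast]
  by_cases hl : l = []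
  · subst hl
    simpa [momentumOrder] using (hC _).1
  by_cases hp : 1 < ‖(r⁻¹ • p).2‖
  · rw [(hC _).2 hl hp, norm_zero, mul_zero]
    positivity
  · have h2 : ‖p.2‖ ≤ r := by
      rw [Prod.smul_snd, norm_smul, norm_inv, Real.norm_of_nonneg hr0.le, not_lt,
        inv_mul_le_iff₀ hr0] at hp
      linarith
    have h3 : (1 + ‖p.2‖) ^ momentumOrder l ≤ 2 ^ l.length * r ^ l.length := by
      rw [← mul_pow]
      calc (1 + ‖p.2‖) ^ momentumOrder l ≤ (2 * r) ^ momentumOrder l := by gcongr; linarith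
        _ ≤ (2 * r) ^ l.length :=
          pow_le_pow_right₀ (by linarith) (momentumOrder_le_length l)
    rw [← div_eq_mul_inv, le_div_iff₀ (by positivity)]
    calc r⁻¹ ^ l.length * ‖dirIter l (scaledCutoff χ 1) (r⁻¹ • p)‖ * (1 + ‖p.2‖) ^ momentumOrder l
        ≤ r⁻¹ ^ l.length * C * (2 ^ l.length * r ^ l.length) := by
          gcongr
          exact (hC _).1
      _ = C * 2 ^ l.length := by
          rw [inv_pow]
          field_simp

theorem exists_truncation_radius (hχ : IsCutoff χ) (hF : IsSym U χ a F c) :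
    ∃ r : ℕ → ℝ, (∀ k, 1 ≤ r k) ∧ ∀ (l : List (Fin n ⊕ Fin n)) (N : ℕ), ∀ ε > (0 : ℝ),
      ∃ k₀ : ℕ, ∀ k ≥ k₀, ∀ p : Euc n × Euc n,
        (1 + ‖p.2‖) ^ (-a.re + N + momentumOrder l : ℝ) *
          ‖dirIter l (fun p => scaledCutoff χ (r k) p *
            (F - ∑ j ∈ Finset.range k, cut χ (c j)) p) p‖ ≤ ε := by
  obtain ⟨δ, hδ, hχ0⟩ := hχ.zero_near
  have hbound : ∀ k : ℕ, SymbolBound (0 + (a.re - k)) (fun (r : Set.Ici (1 : ℝ)) p =>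
      scaledCutoff χ (r : ℝ) p * (F - ∑ j ∈ Finset.range k, cut χ (c j)) p) := fun k =>
    SymbolBound.mul (fun r => contDiff_scaledCutoff hχ r)
      (fun _ => contDiff_sub_sum_cut hχ hF.smooth hF.comp_smooth k)
      (symbolBound_scaledCutoff hχ) fun l =>
        let ⟨C, hC⟩ := hF.estimate k l
        ⟨C, fun _ p => hC () p⟩
  choose C hC using hbound
  have hr : ∀ k : ℕ, ∃ r : ℝ, 1 ≤ r ∧ ∀ l : List (Fin n ⊕ Fin n), l.length ≤ k →
      |C k l| * (1 + δ * r)⁻¹ ≤ 1 / ((k : ℝ) + 1) := by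
    intro k
    have hlim : ∀ l : List (Fin n ⊕ Fin n), ∀ᶠ r : ℝ in atTop,
        |C k l| * (1 + δ * r)⁻¹ ≤ 1 / ((k : ℝ) + 1) := by
      intro l
      have h1 : Tendsto (fun r : ℝ => |C k l| * (1 + δ * r)⁻¹) atTop (𝓝 (|C k l| * 0)) :=
        ((tendsto_atTop_add_const_left _ 1
          (tendsto_id.const_mul_atTop hδ)).inv_tendsto_atTop).const_mul _
      rw [mul_zero] at h1
      exact h1.eventually_le_const (by positivity)
    have hall := ((List.finite_length_le (Fin n ⊕ Fin n) k).eventually_all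
      (l := (atTop : Filter ℝ))).2 fun l _ => hlim l
    obtain ⟨r, h1, h2⟩ := ((eventually_ge_atTop (1 : ℝ)).and hall).exists
    exact ⟨r, h1, fun l hl => h2 l hl⟩
  choose r hr1 hr2 using hr
  refine ⟨r, hr1, fun l N ε hε => ?_⟩
  obtain ⟨k₁, hk₁⟩ := exists_nat_one_div_lt hε
  refine ⟨max k₁ (max l.length (N + 1)), fun k hk p => ?_⟩
  have hkk₁ : k₁ ≤ k := le_trans (le_max_left _ _) hk
  have hkl : l.length ≤ k := (le_max_left _ _).trans ((le_max_right _ _).trans hk)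
  have hkN : N + 1 ≤ k := (le_max_right _ _).trans ((le_max_right _ _).trans hk)
  have hr0 : 0 < r k := lt_of_lt_of_le one_pos (hr1 k)
  have h1 : 0 < 1 + ‖p.2‖ := by linarith [norm_nonneg p.2]
  by_cases hp : ‖p.2‖ < δ * r k
  · rw [dirIter_eq_zero (O := {q : Euc n × Euc n | ‖q.2‖ < δ * r k})
      (isOpen_lt continuous_snd.norm continuous_const) (fun q hq => ?_) l p hp]
    · simpa using hε.le
    · have : χ ((r k)⁻¹ • q.2) = 0 := by
        refine hχ0 _ ?_
        rw [norm_smul, norm_inv, Real.norm_of_nonneg hr0.le, inv_mul_lt_iff₀ hr0, mul_comm]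
        exact hq
      simp [scaledCutoff, this]
  · have h2 := hC k l ⟨r k, hr1 k⟩ p
    have h3 : (1 + ‖p.2‖) ^ (-a.re + N + momentumOrder l : ℝ) *
        (1 + ‖p.2‖) ^ (0 + (a.re - k) - momentumOrder l : ℝ) ≤ (1 + δ * r k)⁻¹ := by
      rw [← Real.rpow_add h1, ← Real.rpow_neg_one]
      have h4 : (N : ℝ) + 1 ≤ k := by exact_mod_cast hkN
      calc (1 + ‖p.2‖) ^ (-a.re + N + momentumOrder l + (0 + (a.re - k) - momentumOrder l) : ℝ)
          ≤ (1 + ‖p.2‖) ^ (-1 : ℝ) :=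
            Real.rpow_le_rpow_of_exponent_le (by linarith [norm_nonneg p.2]) (by linarith)
        _ ≤ (1 + δ * r k) ^ (-1 : ℝ) :=
            Real.rpow_le_rpow_of_nonpos (by positivity) (by linarith) (by norm_num)
    calc _ ≤ (1 + ‖p.2‖) ^ (-a.re + N + momentumOrder l : ℝ) *
          (|C k l| * (1 + ‖p.2‖) ^ (0 + (a.re - k) - momentumOrder l : ℝ)) := by
          gcongr
          exact h2.trans (by gcongr; exact le_abs_self _)
      _ = |C k l| * ((1 + ‖p.2‖) ^ (-a.re + N + momentumOrder l : ℝ) *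
          (1 + ‖p.2‖) ^ (0 + (a.re - k) - momentumOrder l : ℝ)) := by ring
      _ ≤ |C k l| * (1 + δ * r k)⁻¹ := by gcongr
      _ ≤ 1 / ((k : ℝ) + 1) := hr2 k l hkl
      _ ≤ 1 / ((k₁ : ℝ) + 1) := by gcongr
      _ ≤ ε := hk₁.le

theorem isSym_sum_cut (hχ : IsCutoff χ) (hc : ∀ j : ℕ, IsHom U (a - j) (c j)) (k : ℕ) :
    IsSym U χ a (∑ j ∈ Finset.range k, cut χ (c j)) (fun j => if j < k then c j else 0) := by
  induction k with
  | zero => simpa using! (IsTestFn.zero (W := U ×ˢ Set.univ)).isSym (χ := χ) (a := a)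
  | succ k ih =>
    rw [Finset.sum_range_succ]
    convert ih.add hχ ((hc k).isSym_cut hχ) using 1
    ext1 j
    rcases lt_trichotomy j k with h | h | h
    · simp [h, h.trans (Nat.lt_succ_self k), Pi.single_eq_of_ne h.ne]
    · subst h
      simp
    · simp [h.not_gt, show ¬ j < k + 1 by omega, Pi.single_eq_of_ne h.ne']

theorem IsSym.isTestFn_remainder (hχ : IsCutoff χ) (hF : IsSym U χ a F c) {r : ℝ} (hr : 1 ≤ r)
    (k : ℕ) : IsTestFn (U ×ˢ Set.univ) (fun p => (1 - scaledCutoff χ r p) *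
      (F - ∑ j ∈ Finset.range k, cut χ (c j)) p) := by
  obtain ⟨K, hK, hKU, h0⟩ := hF.supp
  refine ⟨(contDiff_const.sub (contDiff_scaledCutoff hχ r)).mul
    (contDiff_sub_sum_cut hχ hF.smooth hF.comp_smooth k), K ×ˢ closedBall 0 r,
    hK.prod (isCompact_closedBall _ _), Set.prod_mono hKU (Set.subset_univ _), fun p hp => ?_⟩
  by_cases hx : p.1 ∈ K
  · have h1 : r < ‖p.2‖ := by
      by_contra h
      exact hp ⟨hx, by simpa using not_lt.1 h⟩
    have h2 : χ (r⁻¹ • p.2) = 1 := by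
      refine hχ.one_far _ ?_
      have hr0 : 0 < r := by linarith
      rw [norm_smul, norm_inv, Real.norm_of_nonneg hr0.le, le_inv_mul_iff₀ hr0, mul_one]
      exact h1.le
    simp [scaledCutoff, h2]
  · have h1 : F p = 0 := (h0 p.1 hx p.2).1
    have h2 : ∀ j, c j p = 0 := fun j => (h0 p.1 hx p.2).2 j
    simp [cut, h1, h2]

end Truncation

/-! ### Linear forms on symbols -/

section SymbolForm

variable {n : ℕ} {U : Set (Euc n)} {χ : Euc n → ℝ} {a b : ℂ} {F : Euc n × Euc n → ℂ}
  {c : ℕ → Euc n × Euc n → ℂ} {h : Euc n × Euc n → ℂ}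

/-- A linear form on functions on phase space which is singular, has Stokes' property, and is
continuous along the truncations of a classical symbol. -/
structure IsSymbolForm (U : Set (Euc n)) (χ : Euc n → ℝ) (R : (Euc n × Euc n → ℂ) →ₗ[ℂ] ℂ) :
    Prop where
  singular : ∀ g, IsTestFn (U ×ˢ Set.univ) g → R g = 0
  stokes : ∀ (b : ℂ) h d, IsHom U b h → R (dirDeriv (dirVec d) (cut χ h)) = 0
  tendsto : ∀ (a : ℂ) F c, IsSym U χ a F c → ∀ r : ℕ → ℝ, (∀ k, 1 ≤ r k) →
    (∀ (l : List (Fin n ⊕ Fin n)) (N : ℕ), ∀ ε > (0 : ℝ),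
      ∃ k₀ : ℕ, ∀ k ≥ k₀, ∀ p : Euc n × Euc n,
        (1 + ‖p.2‖) ^ (-a.re + N + momentumOrder l : ℝ) *
          ‖dirIter l (fun p => scaledCutoff χ (r k) p *
            (F - ∑ j ∈ Finset.range k, cut χ (c j)) p) p‖ ≤ ε) →
    Tendsto (fun k => R (∑ j ∈ Finset.range k, cut χ (c j) +
      fun p => (1 - scaledCutoff χ (r k) p) *
        (F - ∑ j ∈ Finset.range k, cut χ (c j)) p)) atTop (𝓝 (R F))

variable {R : (Euc n × Euc n → ℂ) →ₗ[ℂ] ℂ}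

theorem dirDeriv_cut_sub (hχ : IsCutoff χ) (hh : IsHom U b h) (d : Fin n ⊕ Fin n) :
    IsTestFn (U ×ˢ Set.univ)
      (dirDeriv (dirVec d) (cut χ h) - cut χ (dirDeriv (dirVec d) h)) := by
  obtain ⟨K, hK, hKU, h0⟩ := hh.supp
  refine ⟨((contDiff_cut hχ hh.smooth).dirDeriv _).sub (contDiff_cut hχ (hh.dirDeriv d).smooth),
    K ×ˢ closedBall 0 1, hK.prod (isCompact_closedBall _ _),
    Set.prod_mono hKU (Set.subset_univ _), fun p hp => ?_⟩
  by_cases hx : p.1 ∈ K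
  · have h1 : 1 < ‖p.2‖ := by
      by_contra h
      exact hp ⟨hx, by simpa using not_lt.1 h⟩
    rw [Pi.sub_apply, dirDeriv_eqOn isOpen_one_lt_norm_momentum (cut_eqOn hχ h) _ h1,
      cut_eqOn hχ _ h1, sub_self]
  · have ho := hK.isClosed.isOpen_compl.preimage (continuous_fst (X := Euc n) (Y := Euc n))
    have h1 := dirDeriv_eq_zero ho (F := h) (fun p hp => h0 p.1 hp p.2) (dirVec d) p hx
    have h2 := dirDeriv_eq_zero ho (F := cut χ h)
      (fun p hp => by simp [cut, show h p = 0 from h0 p.1 hp p.2]) (dirVec d) p hx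
    rw [Pi.sub_apply, h2, cut, h1, mul_zero, sub_zero]

theorem IsSymbolForm.cut_dirDeriv (hR : IsSymbolForm U χ R) (hχ : IsCutoff χ)
    (hh : IsHom U b h) (d : Fin n ⊕ Fin n) : R (cut χ (dirDeriv (dirVec d) h)) = 0 := by
  have h1 := hR.singular _ (dirDeriv_cut_sub hχ hh d)
  rw [map_sub, hR.stokes b h d hh, zero_sub, neg_eq_zero] at h1
  exact h1

theorem IsHom.euler (hh : IsHom U b h) {p : Euc n × Euc n} (hp : p.2 ≠ 0) :
    ∑ i, (p.2 i : ℂ) * _root_.dirDeriv (dirVec (.inr i)) h p = b * h p := by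
  have hd : DifferentiableAt ℝ h p :=
    (hh.smooth.contDiffAt (isOpen_momentum_ne_zero.mem_nhds hp)).differentiableAt (by simp)
  have h1 : _root_.dirDeriv (0, p.2) h p = ∑ i, (p.2 i : ℂ) * _root_.dirDeriv (dirVec (.inr i)) h p := by
    have : ((0, p.2) : Euc n × Euc n) = ∑ i, p.2 i • dirVec (.inr i) := by
      refine Prod.ext ?_ ?_
      · simp [Prod.fst_sum, dirVec]
      · rw [Prod.snd_sum]
        ext j
        simp [dirVec, Finset.sum_apply, Pi.single_apply]
    rw [_root_.dirDeriv, this, map_sum]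
    exact Finset.sum_congr rfl fun i _ => by rw [map_smul, real_smul]; rfl
  rw [← h1]
  refine HasDerivAt.dirDeriv_eq hd ?_
  have h2 : HasDerivAt (fun t : ℝ => ((1 + t : ℝ) : ℂ) ^ b) b 0 := by
    by_cases hb : b = 0
    · subst hb
      simpa using hasDerivAt_const (0 : ℝ) (1 : ℂ)
    · have h3 := hasDerivAt_ofReal_cpow_const (x := 1 + 0) (by norm_num) hb
      have h4 := h3.comp_const_add 1 0
      simpa using h4
  have h5 := h2.mul_const (h p)
  refine h5.congr_of_eventuallyEq ?_
  filter_upwards [eventually_gt_nhds (show (-1 : ℝ) < 0 by norm_num)] with t ht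
  have h6 := hh.homog (1 + t) (by linarith) p.1 p.2 hp
  rw [← h6]
  congr 1
  ext <;> simp [add_mul]

theorem IsSymbolForm.cut_eq_zero (hR : IsSymbolForm U χ R) (hχ : IsCutoff χ) (hh : IsHom U b h)
    (hb : b ≠ -(n : ℂ)) : R (cut χ h) = 0 := by
  obtain ⟨ε, hε, h0⟩ := hχ.zero_near
  have key : (n + b) • cut χ h =
      ∑ i, cut χ (dirDeriv (dirVec (.inr i)) fun p => (p.2 i : ℂ) * h p) := by
    ext p
    by_cases hp : p.2 = 0
    · have : χ p.2 = 0 := h0 _ (by simpa [hp] using hε)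
      simp [cut, this]
    · have hd : DifferentiableAt ℝ h p :=
        (hh.smooth.contDiffAt (isOpen_momentum_ne_zero.mem_nhds hp)).differentiableAt (by simp)
      have h1 : ∀ i : Fin n, dirDeriv (dirVec (.inr i)) (fun p => (p.2 i : ℂ) * h p) p =
          h p + (p.2 i : ℂ) * dirDeriv (dirVec (.inr i)) h p := by
        intro i
        have h2 : HasFDerivAt (fun q : Euc n × Euc n => (q.2 i : ℂ))
            (ofRealCLM.comp ((EuclideanSpace.proj (𝕜 := ℝ) i).comp
              (ContinuousLinearMap.snd ℝ (Euc n) (Euc n)))) p :=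
          (ofRealCLM.comp ((EuclideanSpace.proj (𝕜 := ℝ) i).comp
              (ContinuousLinearMap.snd ℝ (Euc n) (Euc n)))).hasFDerivAt
        rw [dirDeriv_mul_apply h2.differentiableAt hd]
        congr 1
        rw [dirDeriv, h2.fderiv]
        simp [dirVec]
      simp only [Finset.sum_apply, cut, Pi.smul_apply, h1]
      rw [← Finset.mul_sum, Finset.sum_add_distrib, hh.euler hp]
      simp only [smul_eq_mul, Finset.sum_const, Finset.card_univ, Fintype.card_fin, nsmul_eq_mul]
      ring
  have h1 : (n + b) • R (cut χ h) = 0 := by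
    rw [← map_smul, key, map_sum]
    exact Finset.sum_eq_zero fun i _ => hR.cut_dirDeriv hχ (hh.coord_mul i) _
  refine (smul_eq_zero.1 h1).resolve_left fun h2 => hb ?_
  linear_combination h2

theorem IsSymbolForm.apply_eq (hR : IsSymbolForm U χ R) (hχ : IsCutoff χ)
    (hF : IsSym U χ a F c) :
    (∀ j : ℕ, a - j = -(n : ℂ) → R F = R (cut χ (c j))) ∧
      ((¬ ∃ j : ℕ, a - j = -(n : ℂ)) → R F = 0) := by
  obtain ⟨r, hr, hlim⟩ := exists_truncation_radius hχ hF
  have h1 := hR.tendsto a F c hF r hr hlim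
  have h2 : ∀ k, R (∑ j ∈ Finset.range k, cut χ (c j) +
      fun p => (1 - scaledCutoff χ (r k) p) * (F - ∑ j ∈ Finset.range k, cut χ (c j)) p) =
      ∑ j ∈ Finset.range k, R (cut χ (c j)) := fun k => by
    rw [map_add, hR.singular _ (hF.isTestFn_remainder hχ (hr k) k), add_zero, map_sum]
  simp only [h2] at h1
  refine ⟨fun j hj => tendsto_nhds_unique h1 (tendsto_const_nhds.congr' ?_), fun hj =>
    tendsto_nhds_unique h1 (tendsto_const_nhds.congr ?_)⟩
  · filter_upwards [eventually_gt_atTop j] with k hk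
    rw [Finset.sum_eq_single_of_mem j (Finset.mem_range.2 hk)]
    intro i _ hi
    refine hR.cut_eq_zero hχ (hF.isHom i) fun h3 => hi ?_
    exact_mod_cast sub_right_injective (h3.trans hj.symm)
  · intro k
    rw [Finset.sum_eq_zero]
    intro i _
    exact hR.cut_eq_zero hχ (hF.isHom i) fun h3 => hj ⟨i, h3⟩

theorem IsSym.mem_span (hχ : IsCutoff χ) (hF : IsSym U χ a F c) :
    (fun x ξ => F (x, ξ)) ∈ CSCptSpan U χ :=
  Submodule.subset_span ⟨a, _, hF.isCSCpt hχ⟩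

theorem IsHom.isSym_cut_self (hχ : IsCutoff χ) (hh : IsHom U b h) :
    IsSym U χ b (cut χ h) (Pi.single 0 h) :=
  IsHom.isSym_cut hχ (by simpa using hh)

theorem exists_isSymbolForm (hχ : IsCutoff χ) (ρ : CSCptSpan U χ →ₗ[ℂ] ℂ)
    (hsing : ∀ σ : CSCptSpan U χ, IsSmoothingCpt U (σ : Euc n → Euc n → ℂ) → ρ σ = 0)
    (hstokesξ : ∀ (τ σ : CSCptSpan U χ) (j : Fin n),
      (σ : Euc n → Euc n → ℂ) = pdSnd j (τ : Euc n → Euc n → ℂ) → ρ σ = 0)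
    (hstokesx : ∀ (τ σ : CSCptSpan U χ) (j : Fin n),
      (σ : Euc n → Euc n → ℂ) = pdFst j (τ : Euc n → Euc n → ℂ) → ρ σ = 0)
    (hcont : ∀ (a : ℂ) (σk : ℕ → CSCptSpan U χ)
      (σck : ℕ → ℕ → Euc n → Euc n → ℂ)
      (σ : CSCptSpan U χ) (σc : ℕ → Euc n → Euc n → ℂ),
      (∀ k, IsCSCpt U χ a (σk k : Euc n → Euc n → ℂ) (σck k)) →
      IsCSCpt U χ a (σ : Euc n → Euc n → ℂ) σc →
      (∀ (Lξ Lx : List (Fin n)), ∀ ε > (0:ℝ), ∃ k₀ : ℕ, ∀ k ≥ k₀, ∀ x ξ : Euc n,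
        (1 + ‖ξ‖) ^ (-a.re + Lξ.length : ℝ) *
          ‖pdIterSnd Lξ (pdIterFst Lx (fun y η =>
            (σk k : Euc n → Euc n → ℂ) y η - (σ : Euc n → Euc n → ℂ) y η)) x ξ‖ ≤ ε) →
      (∀ (Lξ Lx : List (Fin n)) (N : ℕ), ∀ ε > (0:ℝ), ∃ k₀ : ℕ, ∀ k ≥ k₀,
        ∀ x ξ : Euc n,
        (1 + ‖ξ‖) ^ (-a.re + N + Lξ.length : ℝ) *
          ‖pdIterSnd Lξ (pdIterFst Lx (fun y η =>
            ((σk k : Euc n → Euc n → ℂ) y η - (σ : Euc n → Euc n → ℂ) y η)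
              - ∑ j ∈ Finset.range N, (χ η : ℂ) * (σck k j y η - σc j y η))) x ξ‖
          ≤ ε) →
      (∀ (Lξ Lx : List (Fin n)) (j : ℕ), ∀ ε > (0:ℝ), ∃ k₀ : ℕ, ∀ k ≥ k₀,
        ∀ x ξ : Euc n, ‖ξ‖ = 1 →
          ‖pdIterSnd Lξ (pdIterFst Lx (fun y η => σck k j y η - σc j y η)) x ξ‖ ≤ ε) →
      Filter.Tendsto (fun k => ρ (σk k)) Filter.atTop (nhds (ρ σ))) :
    ∃ R : (Euc n × Euc n → ℂ) →ₗ[ℂ] ℂ, IsSymbolForm U χ R ∧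
      ∀ σ : CSCptSpan U χ, R (fun p => (σ : Euc n → Euc n → ℂ) p.1 p.2) = ρ σ := by
  obtain ⟨ρ', hρ'⟩ := LinearMap.exists_extend ρ
  let R : (Euc n × Euc n → ℂ) →ₗ[ℂ] ℂ := ρ' ∘ₗ
    { toFun := fun F x ξ => F (x, ξ), map_add' := fun _ _ => rfl, map_smul' := fun _ _ => rfl }
  have hR : ∀ (F : Euc n × Euc n → ℂ) (hF : (fun x ξ => F (x, ξ)) ∈ CSCptSpan U χ),
      R F = ρ ⟨_, hF⟩ := fun F hF => by
    rw [← hρ']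
    rfl
  refine ⟨R, ⟨fun g hg => ?_, fun b h d hh => ?_, fun a F c hF r hr hlim => ?_⟩, fun σ => ?_⟩
  · rw [hR g ((hg.isSym (a := 0)).mem_span hχ)]
    exact hsing _ hg.isSmoothingCpt
  · have hτ := (hh.isSym_cut_self hχ).mem_span hχ
    have hσ : (fun x ξ => dirDeriv (dirVec d) (cut χ h) (x, ξ)) ∈ CSCptSpan U χ := by
      have h1 := ((dirDeriv_cut_sub hχ hh d).isSym (a := 0)).mem_span hχ
      have h2 := ((hh.dirDeriv d).isSym_cut_self hχ).mem_span hχ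
      convert add_mem h1 h2 using 1
      ext x ξ
      simp
    rw [hR _ hσ]
    have hdiff := (contDiff_cut hχ hh.smooth).differentiable (by simp)
    cases d with
    | inl i => exact hstokesx ⟨_, hτ⟩ _ i (pdFst_eq_dirDeriv hdiff i).symm
    | inr i => exact hstokesξ ⟨_, hτ⟩ _ i (pdSnd_eq_dirDeriv hdiff i).symm
  · set G : ℕ → Euc n × Euc n → ℂ := fun k p => scaledCutoff χ (r k) p *
      (F - ∑ j ∈ Finset.range k, cut χ (c j)) p with hG
    have hGs : ∀ k, ContDiff ℝ ∞ (G k) := fun k => (contDiff_scaledCutoff hχ _).mul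
      (contDiff_sub_sum_cut hχ hF.smooth hF.comp_smooth k)
    set T : ℕ → Euc n × Euc n → ℂ := fun k => ∑ j ∈ Finset.range k, cut χ (c j) +
      fun p => (1 - scaledCutoff χ (r k) p) * (F - ∑ j ∈ Finset.range k, cut χ (c j)) p with hT
    have hTsym : ∀ k, IsSym U χ a (T k) (fun j => if j < k then c j else 0) := fun k => by
      have := (isSym_sum_cut hχ hF.isHom k).add hχ
        ((hF.isTestFn_remainder hχ (hr k) k).isSym (χ := χ) (a := a))
      rwa [add_zero] at this
    have hsub : ∀ k p, T k p - F p = (-G k) p := by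
      intro k p
      simp only [hT, hG, Pi.add_apply, Pi.sub_apply, Pi.neg_apply]
      ring
    have hcomp : ∀ j, ∀ k > j, (if j < k then c j else 0) = c j := fun j k hk => if_pos hk
    have hest : ∀ (Lξ Lx : List (Fin n)) (N : ℕ), ∀ ε > (0 : ℝ), ∃ k₀ : ℕ, ∀ k ≥ k₀,
        ∀ x ξ : Euc n, (1 + ‖ξ‖) ^ (-a.re + N + Lξ.length : ℝ) *
          ‖pdIterSnd Lξ (pdIterFst Lx (fun y η => T k (y, η) - F (y, η))) x ξ‖ ≤ ε := by
      intro Lξ Lx N ε hε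
      obtain ⟨k₀, hk₀⟩ := hlim (Lξ.map .inr ++ Lx.map .inl) N ε hε
      refine ⟨k₀, fun k hk x ξ => ?_⟩
      have h1 := hk₀ k hk (x, ξ)
      rw [momentumOrder_map_inr_append_map_inl] at h1
      simp only [hsub]
      rw [pdIter_eq_dirIter (F := -G k) (hGs k).neg, dirIter_neg]
      simp only [Pi.neg_apply, norm_neg]
      exact h1
    have hRT : (fun k => R (T k)) = fun k => ρ ⟨_, (hTsym k).mem_span hχ⟩ :=
      funext fun k => hR _ ((hTsym k).mem_span hχ)
    change Tendsto (fun k => R (T k)) _ _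
    rw [hR _ (hF.mem_span hχ), hRT]
    refine hcont a (fun k => ⟨_, (hTsym k).mem_span hχ⟩)
      (fun k j x ξ => (if j < k then c j else 0) (x, ξ)) ⟨_, hF.mem_span hχ⟩
      (fun j x ξ => c j (x, ξ)) (fun k => (hTsym k).isCSCpt hχ) (hF.isCSCpt hχ) ?_ ?_ ?_
    · intro Lξ Lx ε hε
      simpa using hest Lξ Lx 0 ε hε
    · intro Lξ Lx N ε hε
      obtain ⟨k₀, hk₀⟩ := hest Lξ Lx N ε hε
      refine ⟨max k₀ N, fun k hk x ξ => ?_⟩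
      have h1 := hk₀ k ((le_max_left _ _).trans hk) x ξ
      have h2 : ∀ y η : Euc n, ∑ j ∈ Finset.range N, (χ η : ℂ) *
          ((if j < k then c j else 0) (y, η) - c j (y, η)) = 0 := fun y η =>
        Finset.sum_eq_zero fun j hj => by
          rw [hcomp j k ((Finset.mem_range.1 hj).trans_le ((le_max_right _ _).trans hk)),
            sub_self, mul_zero]
      simp only [h2, sub_zero]
      exact h1
    · intro Lξ Lx j ε hε
      refine ⟨j + 1, fun k hk x ξ _ => ?_⟩
      simp only [hcomp j k hk, sub_self]
      rw [pdIter_eq_dirIter (F := fun _ : Euc n × Euc n => (0 : ℂ)) contDiff_const Lξ Lx]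
      change ‖dirIter _ (0 : Euc n × Euc n → ℂ) (x, ξ)‖ ≤ ε
      rw [dirIter_zero]
      simpa using hε.le
  · rw [← hρ']
    rfl

end SymbolForm

/-! ### Radial moments -/

section RadialMoment

variable {n : ℕ} {U : Set (Euc n)} {χ : Euc n → ℝ} {h g : Euc n × Euc n → ℂ} {k : ℕ}

/-- The `k`-th moment of a function on phase space along the momentum rays. -/
def radialMoment (k : ℕ) (h : Euc n × Euc n → ℂ) (p : Euc n × Euc n) : ℂ :=
  ∫ t in Set.Ioi (0 : ℝ), (t : ℂ) ^ k * h (p.1, t • p.2)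

theorem radialMoment_eq_integral_mul (k : ℕ) (h : Euc n × Euc n → ℂ) :
    radialMoment k h = fun p => ∫ t : ℝ,
      (Set.Ioi (0 : ℝ)).indicator (fun t => (t : ℂ) ^ k) t * h (p.1, t • p.2) := by
  ext p
  rw [radialMoment, ← integral_indicator measurableSet_Ioi]
  simp only [Set.indicator_mul_left]

theorem locallyIntegrable_indicator_Ioi_pow (k : ℕ) :
    LocallyIntegrable ((Set.Ioi (0 : ℝ)).indicator fun t => (t : ℂ) ^ k) :=
  Continuous.locallyIntegrable (by fun_prop) |>.indicator measurableSet_Ioi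

theorem IsTestFn.exists_ray_support (hh : IsTestFn (U ×ˢ Set.univ) h) {δ : ℝ} (hδ : 0 < δ) :
    ∃ k : Set ℝ, IsCompact k ∧
      ∀ p ∈ {p : Euc n × Euc n | δ < ‖p.2‖}, ∀ t ∉ k, h (p.1, t • p.2) = 0 := by
  obtain ⟨-, K, hK, -, h0⟩ := hh
  obtain ⟨r, hr⟩ := (hK.image continuous_snd).isBounded.exists_norm_le
  refine ⟨closedBall 0 (r / δ), isCompact_closedBall _ _, fun p hp t ht => h0 _ fun hmem => ht ?_⟩
  have h1 : ‖t • p.2‖ ≤ r := hr _ ⟨_, hmem, rfl⟩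
  rw [norm_smul] at h1
  rw [mem_closedBall_zero_iff, le_div_iff₀ hδ]
  exact (mul_le_mul_of_nonneg_left (le_of_lt hp) (norm_nonneg t)).trans h1

theorem isOpen_lt_norm_momentum (δ : ℝ) : IsOpen {p : Euc n × Euc n | δ < ‖p.2‖} :=
  isOpen_lt continuous_const continuous_snd.norm

theorem IsTestFn.contDiff_ray (hh : IsTestFn (U ×ˢ Set.univ) h) :
    ContDiff ℝ ∞ fun q : (Euc n × Euc n) × ℝ => h (q.1.1, q.2 • q.1.2) :=
  hh.1.comp (by fun_prop)

theorem IsTestFn.contDiffOn_radialMoment (hh : IsTestFn (U ×ˢ Set.univ) h) (k : ℕ) :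
    ContDiffOn ℝ ∞ (radialMoment k h) {p | p.2 ≠ 0} := by
  intro p hp
  have hp' : 0 < ‖p.2‖ := norm_pos_iff.2 hp
  obtain ⟨s, hs, h0⟩ := hh.exists_ray_support (half_pos hp')
  have h1 := contDiffOn_integral_mul (locallyIntegrable_indicator_Ioi_pow k)
    (isOpen_lt_norm_momentum _) hs h0 hh.contDiff_ray.contDiffOn
  rw [radialMoment_eq_integral_mul]
  exact (h1.contDiffAt ((isOpen_lt_norm_momentum _).mem_nhds (half_lt_self hp'))).contDiffWithinAt

theorem IsTestFn.isHom_radialMoment (hh : IsTestFn (U ×ˢ Set.univ) h) (k : ℕ) :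
    IsHom U (-(k + 1)) (radialMoment k h) where
  smooth := hh.contDiffOn_radialMoment k
  supp := by
    obtain ⟨-, K, hK, hKU, h0⟩ := hh
    refine ⟨Prod.fst '' K, hK.image continuous_fst, ?_, fun x hx ξ => ?_⟩
    · rintro _ ⟨p, hp, rfl⟩
      exact (hKU hp).1
    · have : ∀ η, h (x, η) = 0 := fun η => h0 _ fun hm => hx ⟨_, hm, rfl⟩
      simp [radialMoment, this]
  homog s hs x ξ _ := by
    have hs' : (s : ℂ) ≠ 0 := ofReal_ne_zero.2 hs.ne'
    have h1 := integral_comp_mul_left_Ioi (fun t : ℝ => (t : ℂ) ^ k * h (x, t • ξ)) 0 hs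
    have h2 : ∀ t : ℝ, ((s * t : ℝ) : ℂ) ^ k * h (x, (s * t) • ξ) =
        (s : ℂ) ^ k * ((t : ℂ) ^ k * h (x, t • s • ξ)) := fun t => by
      rw [smul_smul, mul_comm t s]
      push_cast
      ring
    simp only [h2, mul_zero, integral_const_mul] at h1
    simp only [radialMoment]
    rw [cpow_neg, cpow_add _ _ hs', cpow_natCast, cpow_one, mul_inv, mul_assoc,
      eq_inv_mul_iff_mul_eq₀ (pow_ne_zero _ hs'), h1, real_smul, ofReal_inv]

theorem IsTestFn.dirDeriv_radialMoment (hh : IsTestFn (U ×ˢ Set.univ) h) (k : ℕ)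
    (d : Fin n ⊕ Fin n) {p : Euc n × Euc n} (hp : p.2 ≠ 0) :
    _root_.dirDeriv (dirVec d) (radialMoment k h) p =
      radialMoment (k + momentumOrder [d]) (_root_.dirDeriv (dirVec d) h) p := by
  have hp' : 0 < ‖p.2‖ := norm_pos_iff.2 hp
  obtain ⟨s, hs, h0⟩ := hh.exists_ray_support (half_pos hp')
  simp only [radialMoment_eq_integral_mul]
  rw [dirDeriv_integral_mul (H := fun q : (Euc n × Euc n) × ℝ => h (q.1.1, q.2 • q.1.2))
    (locallyIntegrable_indicator_Ioi_pow k)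
    (isOpen_lt_norm_momentum _) hs h0 hh.contDiff_ray.contDiffOn (half_lt_self hp')]
  congr 1
  ext t
  have h1 := dirDeriv_comp_clm (F := h) (p := p) (momentumScale t)
    (hh.1.differentiable (by simp) _) (dirVec d)
  rw [momentumScale_dirVec] at h1
  simp only [momentumScale_apply] at h1
  rw [h1]
  by_cases ht : t ∈ Set.Ioi (0 : ℝ)
  · simp only [Set.indicator_of_mem ht, _root_.dirDeriv, map_smul, real_smul]
    push_cast
    ring
  · simp [Set.indicator_of_notMem ht]

theorem IsTestFn.integrable_ray (hh : IsTestFn (U ×ˢ Set.univ) h) (k : ℕ) {p : Euc n × Euc n}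
    (hp : p.2 ≠ 0) : Integrable fun t : ℝ => (t : ℂ) ^ k * h (p.1, t • p.2) := by
  have hp' : 0 < ‖p.2‖ := norm_pos_iff.2 hp
  obtain ⟨s, hs, h0⟩ := hh.exists_ray_support (half_pos hp')
  refine Continuous.integrable_of_hasCompactSupport ?_
    (HasCompactSupport.intro hs fun t ht => by rw [h0 p (half_lt_self hp') t ht, mul_zero])
  have := hh.1.continuous
  fun_prop

theorem IsTestFn.radialMoment_add (hh : IsTestFn (U ×ˢ Set.univ) h)
    (hg : IsTestFn (U ×ˢ Set.univ) g) (k : ℕ) {p : Euc n × Euc n} (hp : p.2 ≠ 0) :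
    radialMoment k (h + g) p = radialMoment k h p + radialMoment k g p := by
  simp only [radialMoment, Pi.add_apply, mul_add]
  exact integral_add (hh.integrable_ray k hp).integrableOn (hg.integrable_ray k hp).integrableOn

theorem radialMoment_smul (c : ℂ) (k : ℕ) : radialMoment k (c • h) = c • radialMoment k h := by
  ext p
  simp only [radialMoment, Pi.smul_apply, smul_eq_mul, ← integral_const_mul]
  congr 1
  ext t
  ring

theorem cut_congr (hχ : IsCutoff χ) (H : ∀ p : Euc n × Euc n, p.2 ≠ 0 → h p = g p) :
    cut χ h = cut χ g := by
  obtain ⟨ε, hε, h0⟩ := hχ.zero_near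
  ext p
  by_cases hp : p.2 = 0
  · have : χ p.2 = 0 := h0 _ (by simpa [hp] using hε)
    simp [cut, this]
  · simp [cut, H p hp]

end RadialMoment

/-! ### Linear forms and phase space integrals -/

section Phase

variable {n : ℕ} {U : Set (Euc n)} {χ : Euc n → ℝ} {h : Euc n × Euc n → ℂ}
  {R : (Euc n × Euc n → ℂ) →ₗ[ℂ] ℂ}

/-- The linear coordinates of phase space. -/
def phaseCoord (n : ℕ) : (Euc n × Euc n) ≃L[ℝ] (Fin n ⊕ Fin n → ℝ) :=
  ((EuclideanSpace.equiv (Fin n) ℝ).prodCongr (EuclideanSpace.equiv (Fin n) ℝ)).trans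
    (LinearEquiv.sumArrowLequivProdArrow (Fin n) (Fin n) ℝ ℝ).symm.toContinuousLinearEquiv

theorem coordVec_phaseCoord : coordVec (phaseCoord n) = dirVec := by
  ext1 d
  rw [coordVec, ContinuousLinearEquiv.symm_apply_eq]
  ext e
  rcases d with d | d <;> rcases e with e | e <;>
    simp [phaseCoord, dirVec, Pi.single_apply, LinearEquiv.sumArrowLequivProdArrow]

theorem integral_dirDeriv_eq_zero {W : Set (Euc n × Euc n)} (hh : IsTestFn W h)
    (v : Euc n × Euc n) : ∫ p, dirDeriv v h p = 0 := by
  have : (volume : Measure (Euc n × Euc n)).IsAddHaarMeasure :=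
    inferInstanceAs ((volume : Measure (Euc n)).prod volume).IsAddHaarMeasure
  have h1 := integral_mul_fderiv_eq_neg_fderiv_mul_of_integrable (μ := volume)
    (f := fun _ : Euc n × Euc n => (1 : ℂ)) (g := h) (v := v) (by simp)
    (by simpa using! ((hh.1.dirDeriv v).continuous.integrable_of_hasCompactSupport
      (hh.dirDeriv v).hasCompactSupport))
    (by simpa using! hh.1.continuous.integrable_of_hasCompactSupport hh.hasCompactSupport)
    (fun _ _ => differentiableAt_const _) (fun x _ => hh.1.differentiable (by simp) x)
  simpa [dirDeriv] using h1

theorem IsSymbolForm.cut_radialMoment_eq_zero (hR : IsSymbolForm U χ R) (hχ : IsCutoff χ)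
    (hn : 2 ≤ n) (hh : h ∈ divSpan dirVec (U ×ˢ Set.univ)) :
    IsTestFn (U ×ˢ Set.univ) h ∧ R (cut χ (radialMoment (n - 1) h)) = 0 ∧ ∫ p, h p = 0 := by
  induction hh using Submodule.span_induction with
  | mem f hf =>
    obtain ⟨g, d, hg, rfl⟩ := hf
    refine ⟨hg.dirDeriv _, ?_, integral_dirDeriv_eq_zero hg _⟩
    have hd : momentumOrder [d] ≤ 1 := by cases d <;> simp [momentumOrder]
    rw [← hR.cut_dirDeriv hχ (hg.isHom_radialMoment (n - 1 - momentumOrder [d])) d]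
    congr 1
    refine cut_congr hχ fun p hp => ?_
    rw [hg.dirDeriv_radialMoment _ _ hp, Nat.sub_add_cancel (by omega)]
  | zero =>
    refine ⟨.zero, ?_, by simp⟩
    rw [← zero_smul ℂ (0 : Euc n × Euc n → ℂ), radialMoment_smul, zero_smul]
    convert map_zero R
    ext p
    simp [cut]
  | add f g _ _ hf hg =>
    refine ⟨hf.1.add hg.1, ?_, ?_⟩
    · have h1 : cut χ (radialMoment (n - 1) (f + g)) =
          cut χ (radialMoment (n - 1) f) + cut χ (radialMoment (n - 1) g) := by
        rw [cut_congr hχ (g := radialMoment (n - 1) f + radialMoment (n - 1) g)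
          fun p hp => hf.1.radialMoment_add hg.1 _ hp]
        ext p
        simp [cut, mul_add]
      rw [h1, map_add, hf.2.1, hg.2.1, add_zero]
    · simp only [Pi.add_apply]
      rw [integral_add
        (hf.1.1.continuous.integrable_of_hasCompactSupport hf.1.hasCompactSupport)
        (hg.1.1.continuous.integrable_of_hasCompactSupport hg.1.hasCompactSupport), hf.2.2, hg.2.2,
        add_zero]
  | smul c f _ hf =>
    refine ⟨hf.1.smul c, ?_, ?_⟩
    · have h1 : cut χ (radialMoment (n - 1) (c • f)) = c • cut χ (radialMoment (n - 1) f) := by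
        rw [radialMoment_smul]
        ext p
        simp only [cut, Pi.smul_apply, smul_eq_mul]
        ring
      rw [h1, map_smul, hf.2.1, smul_zero]
    · simp only [Pi.smul_apply, smul_eq_mul]
      rw [integral_const_mul, hf.2.2, mul_zero]

end Phase

section Residue

variable {n : ℕ} {U : Set (Euc n)} {χ : Euc n → ℝ} {f h : Euc n × Euc n → ℂ} {φ : ℝ → ℝ}
  {R : (Euc n × Euc n → ℂ) →ₗ[ℂ] ℂ}

/-- A singular linear form with Stokes' property induces a multiple of the Lebesgue integral on
test functions. -/
theorem IsSymbolForm.exists_cut_radialMoment_eq (hR : IsSymbolForm U χ R) (hχ : IsCutoff χ)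
    (hn : 2 ≤ n) (hU : IsOpen U) (hUconn : IsConnected U) :
    ∃ c : ℂ, ∀ h, IsTestFn (U ×ˢ Set.univ) h →
      R (cut χ (radialMoment (n - 1) h)) = c * ∫ p, h p := by
  obtain ⟨x₀, hx₀⟩ := hUconn.nonempty
  have hW : IsOpen (U ×ˢ (Set.univ : Set (Euc n))) := hU.prod isOpen_univ
  have hWc : IsPreconnected (U ×ˢ (Set.univ : Set (Euc n))) :=
    hUconn.isPreconnected.prod isPreconnected_univ
  obtain ⟨r, hr, hsub⟩ := exists_coordBox_subset (phaseCoord n) hW (p := (x₀, 0)) ⟨hx₀, trivial⟩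
  set Φ : Euc n × Euc n → ℂ := fun p => (coordBump (phaseCoord n) (x₀, 0) hr p : ℂ) with hΦ
  have hΦt : IsTestFn (U ×ˢ Set.univ) Φ := isTestFn_coordBump hr hsub
  have hΦI : ∫ p, Φ p ≠ 0 := by
    have : (volume : Measure (Euc n × Euc n)).IsAddHaarMeasure :=
      inferInstanceAs ((volume : Measure (Euc n)).prod volume).IsAddHaarMeasure
    have hc := contDiff_coordBump (L := phaseCoord n) (x₀, 0) hr
    rw [hΦ, integral_complex_ofReal, ofReal_ne_zero]
    obtain ⟨-, K, hK, -, h0⟩ := hΦt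
    exact (hc.continuous.integral_pos_of_hasCompactSupport_nonneg_nonzero
      (HasCompactSupport.intro hK fun x hx => ofReal_eq_zero.1 (h0 x hx))
      (coordBump_nonneg _ hr) (coordBump_self_pos _ hr).ne').ne'
  refine ⟨R (cut χ (radialMoment (n - 1) Φ)) / ∫ p, Φ p, fun h hh => ?_⟩
  have h1 := isTestFn_mem_divSpan_sup_of_isPreconnected (phaseCoord n) hW hWc hr hsub hh
  rw [coordVec_phaseCoord] at h1
  obtain ⟨u, hu, v, hv, rfl⟩ := Submodule.mem_sup.1 h1
  obtain ⟨κ, rfl⟩ := Submodule.mem_span_singleton.1 hv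
  obtain ⟨hut, hu1, hu2⟩ := hR.cut_radialMoment_eq_zero hχ hn hu
  have h2 : cut χ (radialMoment (n - 1) (u + κ • Φ)) =
      cut χ (radialMoment (n - 1) u) + κ • cut χ (radialMoment (n - 1) Φ) := by
    rw [cut_congr hχ (g := radialMoment (n - 1) u + κ • radialMoment (n - 1) Φ) fun p hp => by
      rw [hut.radialMoment_add (hΦt.smul κ) _ hp, radialMoment_smul]; rfl]
    ext p
    simp only [cut, Pi.add_apply, Pi.smul_apply, smul_eq_mul]
    ring
  have h3 : ∫ p, (u + κ • Φ) p = κ * ∫ p, Φ p := by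
    simp only [Pi.add_apply, Pi.smul_apply, smul_eq_mul]
    rw [integral_add (hut.1.continuous.integrable_of_hasCompactSupport hut.hasCompactSupport)
      ((hΦt.1.continuous.integrable_of_hasCompactSupport hΦt.hasCompactSupport).const_mul κ),
      hu2, zero_add, integral_const_mul]
  change R (cut χ (radialMoment (n - 1) (u + κ • Φ))) = _ * ∫ p, (u + κ • Φ) p
  rw [h2, h3, map_add, map_smul, hu1, smul_eq_mul, zero_add]
  field_simp

theorem exists_radial_bump : ∃ φ : ℝ → ℝ, ContDiff ℝ ∞ φ ∧ (∀ t ∉ Set.Icc (1 : ℝ) 3, φ t = 0) ∧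
    ∫ t in Set.Ioi (0 : ℝ), φ t = 1 := by
  set B : ContDiffBump (2 : ℝ) := ⟨1 / 2, 1, by norm_num, by norm_num⟩
  have h0 : ∀ t ∉ Set.Icc (1 : ℝ) 3, B.normed volume t = 0 := fun t ht =>
    normed_contDiffBump_eq_zero (a := 2) one_pos (by convert ht using 2; norm_num)
  refine ⟨B.normed volume, B.contDiff_normed, h0, ?_⟩
  rw [setIntegral_eq_integral_of_forall_compl_eq_zero, B.integral_normed]
  exact fun t ht => h0 t fun h => ht (lt_of_lt_of_le one_pos h.1)

/-- The product of a function on phase space with a radial weight in the momentum. -/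
def radialWeight (φ : ℝ → ℝ) (f : Euc n × Euc n → ℂ) (p : Euc n × Euc n) : ℂ :=
  ((φ ‖p.2‖ * ‖p.2‖ : ℝ) : ℂ) * f p

theorem IsHom.isTestFn_radialWeight {b : ℂ} (hf : IsHom U b f) (hφ : ContDiff ℝ ∞ φ)
    (hφ0 : ∀ t ∉ Set.Icc (1 : ℝ) 3, φ t = 0) :
    IsTestFn (U ×ˢ Set.univ) (radialWeight φ f) := by
  refine ⟨contDiff_iff_contDiffAt.2 fun p => ?_, ?_⟩
  · by_cases hp : p.2 = 0
    · have : radialWeight φ f =ᶠ[𝓝 p] fun _ => 0 := by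
        have ho : IsOpen {q : Euc n × Euc n | ‖q.2‖ < 1} :=
          isOpen_lt continuous_snd.norm continuous_const
        filter_upwards [ho.mem_nhds (x := p) (by simp [hp])] with q hq
        have : φ ‖q.2‖ = 0 := hφ0 _ fun h => absurd h.1 (not_le.2 hq)
        simp [radialWeight, this]
      exact contDiffAt_const.congr_of_eventuallyEq this
    · have hn : ContDiffAt ℝ ∞ (fun q : Euc n × Euc n => ‖q.2‖) p :=
        contDiffAt_snd.norm ℝ hp
      exact (ofRealCLM.contDiff.contDiffAt.comp p
        ((hφ.contDiffAt.comp p hn).mul hn)).mul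
        (hf.smooth.contDiffAt (isOpen_momentum_ne_zero.mem_nhds hp))
  · obtain ⟨K, hK, hKU, h0⟩ := hf.supp
    refine ⟨K ×ˢ closedBall 0 3, hK.prod (isCompact_closedBall _ _),
      Set.prod_mono hKU (Set.subset_univ _), fun p hp => ?_⟩
    by_cases hx : p.1 ∈ K
    · have : φ ‖p.2‖ = 0 := hφ0 _ fun h => hp ⟨hx, by simpa using h.2⟩
      simp [radialWeight, this]
    · rw [radialWeight, show f p = 0 from h0 p.1 hx p.2, mul_zero]

theorem IsHom.radialMoment_radialWeight (hf : IsHom U (-n) f) (hn : 2 ≤ n)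
    (hφ1 : ∫ t in Set.Ioi (0 : ℝ), φ t = 1) {p : Euc n × Euc n} (hp : p.2 ≠ 0) :
    radialMoment (n - 1) (radialWeight φ f) p = f p := by
  have hp' : 0 < ‖p.2‖ := norm_pos_iff.2 hp
  have h1 : ∀ t ∈ Set.Ioi (0 : ℝ), (t : ℂ) ^ (n - 1) * radialWeight φ f (p.1, t • p.2) =
      ((φ (‖p.2‖ * t) : ℝ) : ℂ) * (‖p.2‖ * f p) := by
    intro t ht
    have ht' : (t : ℂ) ≠ 0 := ofReal_ne_zero.2 (ne_of_gt ht)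
    obtain ⟨m, rfl⟩ : ∃ m, n = m + 1 := ⟨n - 1, by omega⟩
    simp only [radialWeight]
    rw [hf.homog t ht _ _ hp, norm_smul, Real.norm_of_nonneg (le_of_lt ht), cpow_neg,
      cpow_natCast, mul_comm t, Nat.add_sub_cancel, pow_succ]
    push_cast
    field_simp
  rw [radialMoment, setIntegral_congr_fun measurableSet_Ioi h1, integral_mul_const,
    integral_comp_mul_left_Ioi (fun t => ((φ t : ℝ) : ℂ)) 0 hp', mul_zero,
    integral_complex_ofReal, hφ1, real_smul, ofReal_inv, ofReal_one]
  have : (‖p.2‖ : ℂ) ≠ 0 := ofReal_ne_zero.2 hp'.ne'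
  field_simp

theorem IsHom.integral_radialWeight_momentum (hf : IsHom U (-n) f) (hn : 2 ≤ n)
    (hφ1 : ∫ t in Set.Ioi (0 : ℝ), φ t = 1) (x : Euc n) :
    ∫ ξ, radialWeight φ f (x, ξ) = sphInt fun ξ => f (x, ξ) := by
  have h1 : ∀ ξ : ({0}ᶜ : Set (Euc n)), radialWeight φ f (x, ξ) =
      (fun q : sphere (0 : Euc n) 1 × Set.Ioi (0 : ℝ) =>
        f (x, q.1) * (((φ q.2 * q.2 : ℝ) : ℂ) * (q.2 : ℂ) ^ (-n : ℂ)))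
      (homeomorphUnitSphereProd (Euc n) ξ) := by
    intro ξ
    have hξ : (ξ : Euc n) ≠ 0 := ξ.2
    have hξ' : 0 < ‖(ξ : Euc n)‖ := norm_pos_iff.2 hξ
    have h2 := hf.homog ‖(ξ : Euc n)‖ hξ' x (‖(ξ : Euc n)‖⁻¹ • (ξ : Euc n))
      (smul_ne_zero (inv_ne_zero hξ'.ne') hξ)
    rw [smul_smul, mul_inv_cancel₀ hξ'.ne', one_smul] at h2
    simp only [radialWeight, homeomorphUnitSphereProd_apply_fst_coe,
      homeomorphUnitSphereProd_apply_snd_coe]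
    rw [h2]
    ring
  have h3 : ∫ r : Set.Ioi (0 : ℝ), ((φ r * r : ℝ) : ℂ) * (r : ℂ) ^ (-n : ℂ)
      ∂.volumeIoiPow (Module.finrank ℝ (Euc n) - 1) = 1 := by
    simp only [Measure.volumeIoiPow, ENNReal.ofReal]
    rw [integral_withDensity_eq_integral_smul (by fun_prop),
      integral_subtype_comap measurableSet_Ioi fun a : ℝ =>
        Real.toNNReal (a ^ (Module.finrank ℝ (Euc n) - 1)) •
          (((φ a * a : ℝ) : ℂ) * (a : ℂ) ^ (-n : ℂ)),
      setIntegral_congr_fun (g := fun a => ((φ a : ℝ) : ℂ)) measurableSet_Ioi fun a ha => ?_,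
      integral_complex_ofReal, hφ1, ofReal_one]
    have ha' : (a : ℂ) ≠ 0 := ofReal_ne_zero.2 (ne_of_gt ha)
    obtain ⟨m, rfl⟩ : ∃ m, n = m + 1 := ⟨n - 1, by omega⟩
    simp only [finrank_euclideanSpace, Fintype.card_fin, Nat.add_sub_cancel]
    rw [NNReal.smul_def, Real.coe_toNNReal _ (pow_nonneg (le_of_lt ha) _), real_smul, cpow_neg,
      cpow_natCast, pow_succ]
    push_cast
    field_simp
  calc ∫ ξ, radialWeight φ f (x, ξ)
      = ∫ ξ : ({0}ᶜ : Set (Euc n)), radialWeight φ f (x, ξ)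
          ∂(volume.comap Subtype.val) := by
        have : Nontrivial (Euc n) := by
          have : Nonempty (Fin n) := ⟨⟨0, by omega⟩⟩
          infer_instance
        rw [integral_subtype_comap (measurableSet_singleton _).compl
          fun ξ => radialWeight φ f (x, ξ), restrict_compl_singleton]
    _ = sphInt fun ξ => f (x, ξ) := by
        rw [integral_congr_ae (.of_forall h1),
          (volume : Measure (Euc n)).measurePreserving_homeomorphUnitSphereProd.integral_comp
            (Homeomorph.measurableEmbedding _) fun q =>
              f (x, q.1) * (((φ q.2 * q.2 : ℝ) : ℂ) * (q.2 : ℂ) ^ (-n : ℂ))]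
        refine (integral_prod_mul (fun θ : sphere (0 : Euc n) 1 => f (x, (θ : Euc n)))
          (fun r : Set.Ioi (0 : ℝ) => ((φ r * r : ℝ) : ℂ) * (r : ℂ) ^ (-n : ℂ))).trans ?_
        rw [h3, mul_one]
        rfl

theorem IsSymbolForm.exists_cut_eq_integral_sphInt (hR : IsSymbolForm U χ R) (hχ : IsCutoff χ)
    (hn : 2 ≤ n) (hU : IsOpen U) (hUconn : IsConnected U) :
    ∃ c : ℂ, ∀ f, IsHom U (-n) f →
      R (cut χ f) = c * ∫ x in U, sphInt fun ξ => f (x, ξ) := by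
  obtain ⟨c, hc⟩ := hR.exists_cut_radialMoment_eq hχ hn hU hUconn
  obtain ⟨φ, hφ, hφ0, hφ1⟩ := exists_radial_bump
  refine ⟨c, fun f hf => ?_⟩
  have ht := hf.isTestFn_radialWeight hφ hφ0
  have hint : Integrable (radialWeight φ f) ((volume : Measure (Euc n)).prod volume) :=
    ht.1.continuous.integrable_of_hasCompactSupport ht.hasCompactSupport
  rw [← cut_congr hχ fun p hp => hf.radialMoment_radialWeight hn hφ1 hp, hc _ ht,
    Measure.volume_eq_prod, integral_prod _ hint]
  simp only [hf.integral_radialWeight_momentum hn hφ1]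
  rw [setIntegral_eq_integral_of_forall_compl_eq_zero fun x hx => ?_]
  obtain ⟨K, -, hKU, h0⟩ := hf.supp
  simp [sphInt, h0 x fun h => hx (hKU h)]

end Residue

/-- **Uniqueness of the noncommutative residue on `CS_{cpt}(U)`**: a singular linear
form with Stokes' property in both variables which is continuous on symbols of any
fixed order is proportional to the noncommutative residue. -/
theorem resCpt_unique {n : ℕ} (hn : 2 ≤ n) (U : Set (Euc n)) (hU : IsOpen U)
    (hUconn : IsConnected U) {χ : Euc n → ℝ} (hχ : IsCutoff χ)
    (ρ : CSCptSpan U χ →ₗ[ℂ] ℂ)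
    (hsing : ∀ σ : CSCptSpan U χ, IsSmoothingCpt U (σ : Euc n → Euc n → ℂ) → ρ σ = 0)
    (hstokesξ : ∀ (τ σ : CSCptSpan U χ) (j : Fin n),
      (σ : Euc n → Euc n → ℂ) = pdSnd j (τ : Euc n → Euc n → ℂ) → ρ σ = 0)
    (hstokesx : ∀ (τ σ : CSCptSpan U χ) (j : Fin n),
      (σ : Euc n → Euc n → ℂ) = pdFst j (τ : Euc n → Euc n → ℂ) → ρ σ = 0)
    (hcont : ∀ (a : ℂ) (σk : ℕ → CSCptSpan U χ)
      (σck : ℕ → ℕ → Euc n → Euc n → ℂ)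
      (σ : CSCptSpan U χ) (σc : ℕ → Euc n → Euc n → ℂ),
      (∀ k, IsCSCpt U χ a (σk k : Euc n → Euc n → ℂ) (σck k)) →
      IsCSCpt U χ a (σ : Euc n → Euc n → ℂ) σc →
      (∀ (Lξ Lx : List (Fin n)), ∀ ε > (0:ℝ), ∃ k₀ : ℕ, ∀ k ≥ k₀, ∀ x ξ : Euc n,
        (1 + ‖ξ‖) ^ (-a.re + Lξ.length : ℝ) *
          ‖pdIterSnd Lξ (pdIterFst Lx (fun y η =>
            (σk k : Euc n → Euc n → ℂ) y η - (σ : Euc n → Euc n → ℂ) y η)) x ξ‖ ≤ ε) →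
      (∀ (Lξ Lx : List (Fin n)) (N : ℕ), ∀ ε > (0:ℝ), ∃ k₀ : ℕ, ∀ k ≥ k₀,
        ∀ x ξ : Euc n,
        (1 + ‖ξ‖) ^ (-a.re + N + Lξ.length : ℝ) *
          ‖pdIterSnd Lξ (pdIterFst Lx (fun y η =>
            ((σk k : Euc n → Euc n → ℂ) y η - (σ : Euc n → Euc n → ℂ) y η)
              - ∑ j ∈ Finset.range N, (χ η : ℂ) * (σck k j y η - σc j y η))) x ξ‖
          ≤ ε) →
      (∀ (Lξ Lx : List (Fin n)) (j : ℕ), ∀ ε > (0:ℝ), ∃ k₀ : ℕ, ∀ k ≥ k₀,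
        ∀ x ξ : Euc n, ‖ξ‖ = 1 →
          ‖pdIterSnd Lξ (pdIterFst Lx (fun y η => σck k j y η - σc j y η)) x ξ‖ ≤ ε) →
      Filter.Tendsto (fun k => ρ (σk k)) Filter.atTop (nhds (ρ σ))) :
    ∃ c : ℂ, ∀ (σ : CSCptSpan U χ) (a : ℂ) (σc : ℕ → Euc n → Euc n → ℂ),
      IsCSCpt U χ a (σ : Euc n → Euc n → ℂ) σc → ρ σ = c * resCpt U a σc := by
  obtain ⟨R, hR, hRρ⟩ := exists_isSymbolForm hχ ρ hsing hstokesξ hstokesx hcont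
  obtain ⟨c, hc⟩ := hR.exists_cut_eq_integral_sphInt hχ hn hU hUconn
  refine ⟨c * (2 * Real.pi) ^ n, fun σ a σc hσ => ?_⟩
  have hF := hσ.isSym hχ
  obtain ⟨h1, h2⟩ := hR.apply_eq hχ hF
  rw [← hRρ σ, resCpt]
  split_ifs with h
  · have hf := hF.isHom h.choose
    rw [h.choose_spec] at hf
    rw [h1 _ h.choose_spec, hc _ hf]
    have : (Real.pi : ℂ) ≠ 0 := ofReal_ne_zero.2 Real.pi_ne_zero
    push_cast
    field_simp
  · rw [h2 h, mul_zero]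

end
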